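/- arXiv:math/0701827 — 2 statements merged into one kernel-verified Lean document; each statement's English description precedes it below -/
import Mathlib

section
/- For each n ≥ 1 let p_n be a probability distribution on the positive integers and X_n a random variable with distribution p_n, with μ_n := E[log X_n] ∈ (0, ∞). Assume μ_n = o(log n) as n → ∞, and that for every fixed η > 0, E[(log X_n)·1{log X_n > η·log n}] = o(μ_n) as n → ∞. Set t_n = (3·log n)/(2·μ_n). Then for every ε ∈ (0,1): for every sequence of integers (k_n) with k_n > (1+ε)·t_n for all n, lim_{n→∞} ‖Q_{n,p_n}^{k_n} − U_n‖_TV = 0; and for every sequence of nonnegative integers (k_n) with k_n < (1−ε)·t_n for all n, lim_{n→∞} ‖Q_{n,p_n}^{k_n} − U_n‖_TV = 1. -/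
open Filter MeasureTheory
open scoped BigOperators NNReal ENNReal

noncomputable section

/-- The value of `σ⁻¹` at position `i` (0-indexed), as a natural number; `0` out of range. -/
def invAt (n : ℕ) (σ : Equiv.Perm (Fin n)) (i : ℕ) : ℕ :=
  if h : i < n then ((σ⁻¹ ⟨i, h⟩ : Fin n) : ℕ) else 0

/-- The number of rising sequences of a permutation: one plus the number of descents
of its inverse. -/
def rSeq (n : ℕ) (σ : Equiv.Perm (Fin n)) : ℕ :=
  1 + ((Finset.range (n - 1)).filter fun i => invAt n σ (i + 1) < invAt n σ i).card

/-- The `m`-shuffle distribution on `S_n`:  `Q_{n,m}(σ) = m^{-n} C(n + m - r(σ), n)`. -/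
def Qs (n m : ℕ) (σ : Equiv.Perm (Fin n)) : ℝ :=
  ((m : ℝ) ^ n)⁻¹ * (Nat.choose (n + m - rSeq n σ) n : ℝ)

/-- The uniform distribution on `S_n`. -/
def Us (n : ℕ) (_ : Equiv.Perm (Fin n)) : ℝ := (n.factorial : ℝ)⁻¹

/-- Total variation distance between two probability distributions on `S_n`. -/
def tv (n : ℕ) (μ ν : Equiv.Perm (Fin n) → ℝ) : ℝ :=
  (1 / 2) * ∑ σ : Equiv.Perm (Fin n), |μ σ - ν σ|

/-- Convolution of two distributions on `S_n`. -/
def convol (n : ℕ) (μ ν : Equiv.Perm (Fin n) → ℝ) : Equiv.Perm (Fin n) → ℝ :=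
  fun σ => ∑ τ : Equiv.Perm (Fin n), μ (σ * τ⁻¹) * ν τ

/-- `k`-fold convolution power; the `0`-th power is the point mass at the identity. -/
def iterConv (n : ℕ) (μ : Equiv.Perm (Fin n) → ℝ) : ℕ → Equiv.Perm (Fin n) → ℝ
  | 0 => fun σ => if σ = 1 then 1 else 0
  | k + 1 => convol n μ (iterConv n μ k)

/-- `Ψ(x) = (2π)^{-1/2} ∫_{-x/(4√3)}^{x/(4√3)} e^{-t²/2} dt`. -/
def Psi (x : ℝ) : ℝ :=
  (Real.sqrt (2 * Real.pi))⁻¹ *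
    ∫ t in (-(x / (4 * Real.sqrt 3)))..(x / (4 * Real.sqrt 3)), Real.exp (-t ^ 2 / 2)

/-- The `p`-shuffle distribution on `S_n` for a probability `p` on the positive integers. -/
def Qp (n : ℕ) (p : ℕ → ℝ) (σ : Equiv.Perm (Fin n)) : ℝ := ∑' m : ℕ, p m * Qs n m σ

/-- The number of words in `m` letters whose stable sorting permutation is `π`. -/
def sortCount (n m : ℕ) (π : Equiv.Perm (Fin n)) : ℕ :=
  (Finset.univ.filter fun v : Fin n → Fin m => Tuple.sort v = π).card

/-- The number of ascents of `σ⁻¹` among the first `i` positions. -/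
def ascCount (n : ℕ) (σ : Equiv.Perm (Fin n)) (i : ℕ) : ℕ :=
  ((Finset.range i).filter fun j => ¬ invAt n σ (j + 1) < invAt n σ j).card

lemma ascCount_zero (n : ℕ) (σ : Equiv.Perm (Fin n)) : ascCount n σ 0 = 0 := by
  simp [ascCount]

lemma ascCount_succ (n : ℕ) (σ : Equiv.Perm (Fin n)) (i : ℕ) :
    ascCount n σ (i + 1) =
      ascCount n σ i + if invAt n σ (i + 1) < invAt n σ i then 0 else 1 := by
  unfold ascCount
  rw [Finset.range_add_one, Finset.filter_insert]
  split_ifs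
  · rfl
  · rw [Finset.card_insert_of_notMem (by simp)]

lemma rSeq_add_ascCount (k : ℕ) (σ : Equiv.Perm (Fin (k + 1))) :
    rSeq (k + 1) σ + ascCount (k + 1) σ k = k + 1 := by
  have := Finset.card_filter_add_card_filter_not (s := Finset.range k)
    (fun i => invAt (k + 1) σ (i + 1) < invAt (k + 1) σ i)
  simp only [rSeq, ascCount, Finset.card_range, Nat.add_sub_cancel] at this ⊢
  omega

lemma one_le_rSeq (n : ℕ) (σ : Equiv.Perm (Fin n)) : 1 ≤ rSeq n σ := by
  simp [rSeq]

lemma rSeq_le (n : ℕ) (hn : 1 ≤ n) (σ : Equiv.Perm (Fin n)) : rSeq n σ ≤ n := by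
  obtain ⟨k, rfl⟩ : ∃ k, n = k + 1 := ⟨n - 1, by omega⟩
  have := rSeq_add_ascCount k σ
  omega

lemma sort_eq_iff_step {k : ℕ} {α : Type*} [LinearOrder α] (v : Fin (k + 1) → α)
    (π : Equiv.Perm (Fin (k + 1))) :
    Tuple.sort v = π ↔ ∀ i : Fin k, v (π i.castSucc) < v (π i.succ) ∨
      (v (π i.castSucc) = v (π i.succ) ∧ π i.castSucc < π i.succ) := by
  rw [eq_comm, Tuple.eq_sort_iff', Fin.strictMono_iff_lt_succ]
  refine forall_congr' fun i => ?_
  exact Prod.Lex.toLex_lt_toLex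

lemma sortCount_inv_eq_choose_aux (k m : ℕ) (σ : Equiv.Perm (Fin (k + 1))) :
    sortCount (k + 1) m σ⁻¹ = (m + ascCount (k + 1) σ k).choose (k + 1) := by
  have hinv : ∀ i : Fin (k + 1), invAt (k + 1) σ i = (σ⁻¹ i : Fin (k + 1)) := by
    intro i
    rw [invAt, dif_pos i.isLt]
  have hσ : ∀ x, σ (σ⁻¹ x) = x := σ.apply_symm_apply
  have hstep : ∀ i : Fin k, ascCount (k + 1) σ (i + 1) =
      ascCount (k + 1) σ i + if σ⁻¹ i.succ < σ⁻¹ i.castSucc then 0 else 1 := by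
    intro i
    have h1 := hinv i.succ
    have h2 := hinv i.castSucc
    simp only [Fin.val_succ, Fin.val_castSucc] at h1 h2
    rw [ascCount_succ, h1, h2]
    rfl
  have hlt : ∀ i : Fin k, ¬ σ⁻¹ i.succ < σ⁻¹ i.castSucc ↔ σ⁻¹ i.castSucc < σ⁻¹ i.succ := by
    intro i
    rw [not_lt]
    refine ⟨fun h => lt_of_le_of_ne h ?_, le_of_lt⟩
    intro h
    exact (Fin.castSucc_lt_succ (i := i)).ne (σ⁻¹.injective h)
  have hmono : Monotone (ascCount (k + 1) σ) :=
    monotone_nat_of_le_succ fun i => by rw [ascCount_succ]; omega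
  have hbound : ∀ g : Fin (k + 1) ↪o Fin (m + ascCount (k + 1) σ k), ∀ i : Fin (k + 1),
      ascCount (k + 1) σ i ≤ g i ∧ (g i : ℕ) < m + ascCount (k + 1) σ i := by
    intro g i
    have hm : Monotone fun i : Fin (k + 1) => ((g i : ℕ) : ℤ) - ascCount (k + 1) σ i := by
      rw [Fin.monotone_iff_le_succ]
      intro i
      have h1 : (g i.castSucc : ℕ) < g i.succ := g.strictMono Fin.castSucc_lt_succ
      have h2 := hstep i
      simp only [Fin.val_succ, Fin.val_castSucc]
      rw [h2]
      split_ifs <;> push_cast <;> omega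
    have h0 := hm (Fin.zero_le i)
    have h1 := hm (Fin.le_last i)
    have h2 := (g (Fin.last k)).isLt
    simp only [Fin.val_zero, ascCount_zero, Fin.val_last] at h0 h1
    omega
  let e : {v : Fin (k + 1) → Fin m // Tuple.sort v = σ⁻¹} ≃
      (Fin (k + 1) ↪o Fin (m + ascCount (k + 1) σ k)) :=
    { toFun := fun v => OrderEmbedding.ofStrictMono
        (fun i => ⟨v.1 (σ⁻¹ i) + ascCount (k + 1) σ i,
          add_lt_add_of_lt_of_le (Fin.is_lt _) (hmono (by omega))⟩) (by
          rw [Fin.strictMono_iff_lt_succ]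
          intro i
          have h := (sort_eq_iff_step v.1 σ⁻¹).1 v.2 i
          rw [Fin.lt_def]
          simp only [Fin.val_succ, Fin.val_castSucc]
          rw [hstep i]
          rcases h with h | ⟨h, h'⟩
          · rw [Fin.lt_def] at h
            omega
          · rw [if_neg ((hlt i).2 h'), h]
            omega)
      invFun := fun g => ⟨fun x => ⟨g (σ x) - ascCount (k + 1) σ (σ x), by
          have := hbound g (σ x)
          omega⟩, by
          rw [sort_eq_iff_step]
          intro i
          have h1 : (g i.castSucc : ℕ) < g i.succ := g.strictMono Fin.castSucc_lt_succ
          have h2 := hstep i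
          have h3 := hbound g i.castSucc
          have h4 := hbound g i.succ
          simp only [Fin.val_succ, Fin.val_castSucc] at h3 h4
          simp only [hσ, Fin.lt_def, Fin.ext_iff, Fin.val_succ,
            Fin.val_castSucc]
          by_cases hd : σ⁻¹ i.succ < σ⁻¹ i.castSucc
          · rw [if_pos hd] at h2
            omega
          · rw [if_neg hd] at h2
            rw [hlt i, Fin.lt_def] at hd
            omega⟩
      left_inv := fun v => by
        ext x
        simp
      right_inv := fun g => by
        ext i
        have := hbound g i
        simp
        omega }
  rw [sortCount, ← Fintype.card_subtype, ← Nat.card_eq_fintype_card, Nat.card_congr e,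
    Nat.card_congr Set.powersetCard.ofFinEmbEquiv, Set.powersetCard.card]
  simp

lemma sortCount_inv_eq_choose (n m : ℕ) (hn : 1 ≤ n) (σ : Equiv.Perm (Fin n)) :
    sortCount n m σ⁻¹ = (n + m - rSeq n σ).choose n := by
  obtain ⟨k, rfl⟩ : ∃ k, n = k + 1 := ⟨n - 1, by omega⟩
  rw [sortCount_inv_eq_choose_aux]
  have := rSeq_add_ascCount k σ
  congr 1
  omega

lemma sum_sortCount (n m : ℕ) : ∑ π : Equiv.Perm (Fin n), sortCount n m π = m ^ n := by
  simp only [sortCount]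
  rw [← Finset.card_eq_sum_card_fiberwise (f := Tuple.sort) (t := Finset.univ)
    (fun _ _ => Finset.mem_coe.2 (Finset.mem_univ _))]
  simp

lemma sort_lex (n a b : ℕ) (u : Fin n → Fin a) (v : Fin n → Fin b) :
    Tuple.sort (fun i => finProdFinEquiv (u i, v i)) =
      Tuple.sort v * Tuple.sort (u ∘ Tuple.sort v) := by
  have hlt : ∀ x y : Fin a × Fin b, finProdFinEquiv x < finProdFinEquiv y ↔
      x.1 < y.1 ∨ (x.1 = y.1 ∧ x.2 < y.2) := by
    intro x y
    rw [Fin.lt_def]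
    simp only [finProdFinEquiv_apply_val]
    have hx := x.2.isLt
    have hy := y.2.isLt
    rw [Fin.lt_def, Fin.ext_iff, Fin.lt_def]
    rcases lt_trichotomy (x.1 : ℕ) y.1 with h | h | h
    · have : b * (x.1 + 1) ≤ b * y.1 := Nat.mul_le_mul_left _ h
      rw [mul_add] at this
      omega
    · rw [h]; omega
    · have : b * (y.1 + 1) ≤ b * x.1 := Nat.mul_le_mul_left _ h
      rw [mul_add] at this
      omega
  symm
  obtain ⟨hv1, hv2⟩ := Tuple.eq_sort_iff.1 (rfl : Tuple.sort v = Tuple.sort v)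
  obtain ⟨hu1, hu2⟩ :=
    Tuple.eq_sort_iff.1 (rfl : Tuple.sort (u ∘ Tuple.sort v) = Tuple.sort (u ∘ Tuple.sort v))
  set s := Tuple.sort v
  set t := Tuple.sort (u ∘ s)
  rw [Tuple.eq_sort_iff]
  constructor
  · intro i j hij
    rcases hij.eq_or_lt with rfl | hij
    · exact le_rfl
    simp only [Function.comp, Equiv.Perm.mul_apply]
    by_contra hcon
    rw [not_le, hlt] at hcon
    have h1 := hu1 hij.le
    simp only [Function.comp] at h1
    rcases hcon with h | ⟨h, h'⟩
    · exact absurd h1 (not_le.2 h)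
    · have h2 := hu2 i j hij h.symm
      exact absurd (hv1 h2.le) (not_le.2 h')
  · intro i j hij h
    have h' := finProdFinEquiv.injective h
    rw [Prod.mk.injEq] at h'
    exact hv2 _ _ (hu2 i j hij h'.1) h'.2

lemma sortCount_mul (n a b : ℕ) (π : Equiv.Perm (Fin n)) :
    sortCount n (a * b) π =
      ∑ τ : Equiv.Perm (Fin n), sortCount n b τ * sortCount n a (τ⁻¹ * π) := by
  have key : ∀ τ : Equiv.Perm (Fin n), sortCount n b τ * sortCount n a (τ⁻¹ * π) =
      ((Finset.univ.filter fun w : Fin n → Fin (a * b) => Tuple.sort w = π).filter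
        fun w => Tuple.sort (fun i => (finProdFinEquiv.symm (w i)).2) = τ).card := by
    intro τ
    rw [sortCount, sortCount, ← Finset.card_product]
    refine Finset.card_bij' (fun x _ i => finProdFinEquiv (x.2 (τ⁻¹ i), x.1 i))
      (fun w _ => (fun i => (finProdFinEquiv.symm (w i)).2,
        fun i => (finProdFinEquiv.symm (w (τ i))).1)) ?_ ?_ ?_ ?_
    · rintro ⟨v, u⟩ h
      simp only [Finset.mem_product, Finset.mem_filter, Finset.mem_univ, true_and] at h
      simp only [Finset.mem_filter, Finset.mem_univ, true_and, Equiv.symm_apply_apply]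
      refine ⟨?_, h.1⟩
      rw [sort_lex n a b (fun i => u (τ⁻¹ i)) v, h.1]
      have : (fun i => u (τ⁻¹ i)) ∘ τ = u := by ext i; simp
      rw [this, h.2]
      simp
    · intro w h
      simp only [Finset.mem_filter, Finset.mem_univ, true_and] at h
      simp only [Finset.mem_product, Finset.mem_filter, Finset.mem_univ, true_and]
      refine ⟨h.2, ?_⟩
      have hl := sort_lex n a b (fun i => (finProdFinEquiv.symm (w i)).1)
        (fun i => (finProdFinEquiv.symm (w i)).2)
      simp only [Prod.mk.eta, Equiv.apply_symm_apply] at hl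
      rw [h.1, h.2] at hl
      rw [hl]
      simp [Function.comp_def]
    · rintro ⟨v, u⟩ h
      simp
    · intro w h
      funext i
      have : τ (τ⁻¹ i) = i := τ.apply_symm_apply i
      simp only [this, Prod.mk.eta, Equiv.apply_symm_apply]
  simp_rw [key]
  exact Finset.card_eq_sum_card_fiberwise (fun _ _ => Finset.mem_coe.2 (Finset.mem_univ _))

lemma sortCount_one (n : ℕ) (π : Equiv.Perm (Fin n)) :
    sortCount n 1 π = if π = 1 then 1 else 0 := by
  have h : ∀ v : Fin n → Fin 1, Tuple.sort v = 1 := fun v =>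
    Tuple.sort_eq_refl_iff_monotone.2 fun i j _ => (Subsingleton.elim _ _).le
  simp only [sortCount, h]
  split_ifs with hp
  · subst hp; simp
  · simp [Ne.symm hp]

lemma Qs_eq_sortCount (n m : ℕ) (hn : 1 ≤ n) (σ : Equiv.Perm (Fin n)) :
    Qs n m σ = ((m : ℝ) ^ n)⁻¹ * sortCount n m σ⁻¹ := by
  rw [Qs, sortCount_inv_eq_choose n m hn]

lemma Qs_nonneg (n m : ℕ) (σ : Equiv.Perm (Fin n)) : 0 ≤ Qs n m σ := by
  unfold Qs; positivity

lemma sum_Qs (n m : ℕ) (hn : 1 ≤ n) (hm : 1 ≤ m) : ∑ σ, Qs n m σ = 1 := by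
  simp_rw [Qs_eq_sortCount n m hn]
  have h := Equiv.sum_comp (Equiv.inv (Equiv.Perm (Fin n))) (fun π => (sortCount n m π : ℝ))
  simp only [Equiv.inv_apply] at h
  rw [← Finset.mul_sum, h, ← Nat.cast_sum, sum_sortCount]
  push_cast
  exact inv_mul_cancel₀ (by positivity)

lemma Qs_zero (n : ℕ) (hn : 1 ≤ n) (σ : Equiv.Perm (Fin n)) : Qs n 0 σ = 0 := by
  simp [Qs, zero_pow (show n ≠ 0 by omega)]

lemma sum_Qs_le_one (n m : ℕ) (hn : 1 ≤ n) (B : Finset (Equiv.Perm (Fin n))) :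
    ∑ σ ∈ B, Qs n m σ ≤ 1 := by
  rcases Nat.eq_zero_or_pos m with rfl | hm
  · simp [Qs_zero n hn]
  · rw [← sum_Qs n m hn hm]
    exact Finset.sum_le_univ_sum_of_nonneg fun σ => Qs_nonneg n m σ

lemma Qs_le_one (n m : ℕ) (hn : 1 ≤ n) (σ : Equiv.Perm (Fin n)) : Qs n m σ ≤ 1 := by
  simpa using sum_Qs_le_one n m hn {σ}

lemma convol_Qs (n a b : ℕ) (hn : 1 ≤ n) (σ : Equiv.Perm (Fin n)) :
    ∑ τ, Qs n a (σ * τ⁻¹) * Qs n b τ = Qs n (a * b) σ := by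
  simp_rw [Qs_eq_sortCount _ _ hn]
  rw [sortCount_mul, ← Equiv.sum_comp (Equiv.inv (Equiv.Perm (Fin n)))]
  push_cast
  rw [Finset.mul_sum]
  refine Finset.sum_congr rfl fun τ _ => ?_
  simp only [Equiv.inv_apply, inv_inv, mul_inv_rev, mul_pow]
  ring

lemma Qs_one (n : ℕ) (hn : 1 ≤ n) (σ : Equiv.Perm (Fin n)) :
    Qs n 1 σ = if σ = 1 then 1 else 0 := by
  rw [Qs_eq_sortCount n 1 hn, sortCount_one]
  simp

/-- The sign `±1` recording whether `σ⁻¹` descends or ascends at `i`. -/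
def descSign (n : ℕ) (σ : Equiv.Perm (Fin n)) (i : ℕ) : ℝ :=
  if invAt n σ (i + 1) < invAt n σ i then 1 else -1

/-- Twice the deviation of the number of rising sequences from its uniform mean. -/
def rDev (n : ℕ) (σ : Equiv.Perm (Fin n)) : ℝ := 2 * rSeq n σ - n - 1

lemma sum_descSign (n : ℕ) (hn : 1 ≤ n) (σ : Equiv.Perm (Fin n)) :
    ∑ i ∈ Finset.range (n - 1), descSign n σ i = rDev n σ := by
  obtain ⟨k, rfl⟩ : ∃ k, n = k + 1 := ⟨n - 1, by omega⟩
  have h : (rSeq (k + 1) σ : ℝ) + ascCount (k + 1) σ k = k + 1 := by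
    exact_mod_cast rSeq_add_ascCount k σ
  simp only [descSign, rDev, Finset.sum_ite, Nat.add_sub_cancel]
  simp only [Finset.sum_const, nsmul_eq_mul, mul_one, mul_neg]
  simp only [rSeq, ascCount, Nat.add_sub_cancel] at h ⊢
  push_cast at h ⊢
  linarith

lemma sum_descSign_mul_eq_zero (n i j : ℕ) (hi : i < n - 1) (hij : i + 1 < j ∨ j + 1 < i) :
    ∑ σ : Equiv.Perm (Fin n), descSign n σ i * descSign n σ j = 0 := by
  have hi0 : i < n := by omega
  have hi1 : i + 1 < n := by omega
  set s : Equiv.Perm (Fin n) := Equiv.swap ⟨i, hi0⟩ ⟨i + 1, hi1⟩ with hs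
  have hinv : ∀ (σ : Equiv.Perm (Fin n)) (l : ℕ) (h : l < n),
      invAt n (s * σ) l = (σ⁻¹ (s ⟨l, h⟩) : Fin n) := by
    intro σ l h
    rw [invAt, dif_pos h, mul_inv_rev, Equiv.Perm.mul_apply, hs, Equiv.swap_inv]
  have h0 : ∀ σ, invAt n (s * σ) i = invAt n σ (i + 1) := by
    intro σ
    rw [hinv σ i hi0, hs, Equiv.swap_apply_left, invAt, dif_pos hi1]
  have h1 : ∀ σ, invAt n (s * σ) (i + 1) = invAt n σ i := by
    intro σ
    rw [hinv σ (i + 1) hi1, hs, Equiv.swap_apply_right, invAt, dif_pos hi0]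
  have h2 : ∀ σ l, l ≠ i → l ≠ i + 1 → invAt n (s * σ) l = invAt n σ l := by
    intro σ l hl hl'
    by_cases h : l < n
    · rw [hinv σ l h, hs, Equiv.swap_apply_of_ne_of_ne, invAt, dif_pos h]
      · simpa [Fin.ext_iff] using hl
      · simpa [Fin.ext_iff] using hl'
    · rw [invAt, invAt, dif_neg h, dif_neg h]
  have hne : ∀ σ, invAt n σ i ≠ invAt n σ (i + 1) := by
    intro σ h
    rw [invAt, invAt, dif_pos hi0, dif_pos hi1] at h
    have := σ⁻¹.injective (Fin.ext h)
    simp [Fin.ext_iff] at this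
  have hflip : ∀ σ, descSign n (s * σ) i * descSign n (s * σ) j =
      -(descSign n σ i * descSign n σ j) := by
    intro σ
    have hj : descSign n (s * σ) j = descSign n σ j := by
      unfold descSign
      rw [h2 σ j (by omega) (by omega), h2 σ (j + 1) (by omega) (by omega)]
    have hi : descSign n (s * σ) i = - descSign n σ i := by
      unfold descSign
      rw [h0, h1]
      rcases lt_or_gt_of_ne (hne σ) with h | h
      · rw [if_pos h, if_neg (not_lt.2 h.le), neg_neg]
      · rw [if_neg (not_lt.2 h.le), if_pos h]
    rw [hi, hj, neg_mul]
  have hsum := Equiv.sum_comp (Equiv.mulLeft s) fun σ => descSign n σ i * descSign n σ j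
  simp only [Equiv.coe_mulLeft, hflip, Finset.sum_neg_distrib] at hsum
  linarith

lemma sum_rDev_sq_le (n : ℕ) (hn : 1 ≤ n) :
    ∑ σ : Equiv.Perm (Fin n), rDev n σ ^ 2 ≤ 3 * n * n.factorial := by
  have habs : ∀ σ i, |descSign n σ i| = 1 := by
    intro σ i; unfold descSign; split_ifs <;> simp
  have hpair : ∀ i ∈ Finset.range (n - 1), ∀ j,
      ∑ σ : Equiv.Perm (Fin n), descSign n σ i * descSign n σ j ≤
        if j ∈ Finset.Icc (i - 1) (i + 1) then (n.factorial : ℝ) else 0 := by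
    intro i hi j
    split_ifs with h
    · calc ∑ σ : Equiv.Perm (Fin n), descSign n σ i * descSign n σ j
          ≤ ∑ σ : Equiv.Perm (Fin n), (1 : ℝ) := Finset.sum_le_sum fun σ _ => by
            refine (le_abs_self _).trans ?_
            rw [abs_mul, habs, habs, one_mul]
        _ = n.factorial := by simp [Fintype.card_perm]
    · rw [Finset.mem_Icc] at h
      rw [sum_descSign_mul_eq_zero n i j (Finset.mem_range.1 hi) (by omega)]
  simp_rw [← sum_descSign n hn, sq, Finset.sum_mul_sum]
  rw [Finset.sum_comm]
  simp_rw [Finset.sum_comm (s := (Finset.univ : Finset (Equiv.Perm (Fin n))))]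
  calc ∑ i ∈ Finset.range (n - 1), ∑ j ∈ Finset.range (n - 1),
        ∑ σ : Equiv.Perm (Fin n), descSign n σ i * descSign n σ j
      ≤ ∑ i ∈ Finset.range (n - 1), ∑ j ∈ Finset.range (n - 1),
        if j ∈ Finset.Icc (i - 1) (i + 1) then (n.factorial : ℝ) else 0 :=
        Finset.sum_le_sum fun i hi => Finset.sum_le_sum fun j _ => hpair i hi j
    _ ≤ ∑ i ∈ Finset.range (n - 1), (3 : ℝ) * n.factorial := by
        refine Finset.sum_le_sum fun i _ => ?_
        rw [← Finset.sum_filter, Finset.sum_const, nsmul_eq_mul]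
        refine mul_le_mul_of_nonneg_right ?_ (by positivity)
        have h : ((Finset.range (n - 1)).filter fun j => j ∈ Finset.Icc (i - 1) (i + 1)).card ≤
            (Finset.Icc (i - 1) (i + 1)).card :=
          Finset.card_le_card fun j hj => (Finset.mem_filter.1 hj).2
        rw [Nat.card_Icc] at h
        exact_mod_cast h.trans (show i + 1 + 1 - (i - 1) ≤ 3 by omega)
    _ ≤ 3 * n * n.factorial := by
        rw [Finset.sum_const, nsmul_eq_mul, Finset.card_range]
        have : ((n - 1 : ℕ) : ℝ) ≤ n := by exact_mod_cast Nat.sub_le n 1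
        nlinarith [show (0 : ℝ) ≤ n.factorial by positivity]

lemma sum_Us (n : ℕ) : ∑ σ, Us n σ = 1 := by
  simp only [Us, Finset.sum_const, Finset.card_univ, Fintype.card_perm, Fintype.card_fin,
    nsmul_eq_mul]
  exact mul_inv_cancel₀ (by positivity)

lemma Us_nonneg (n : ℕ) (σ : Equiv.Perm (Fin n)) : 0 ≤ Us n σ := by
  unfold Us; positivity

/-- Permutations whose number of rising sequences deviates by less than `x / 2` from its
uniform mean. -/
def typicalSet (n : ℕ) (x : ℝ) : Finset (Equiv.Perm (Fin n)) :=
  Finset.univ.filter fun σ => |rDev n σ| < x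

lemma sum_Us_typicalSet (n : ℕ) (hn : 1 ≤ n) (x : ℝ) (hx : 0 < x) :
    1 - 3 * n / x ^ 2 ≤ ∑ σ ∈ typicalSet n x, Us n σ := by
  have h1 : ∑ σ, Us n σ * (1 - rDev n σ ^ 2 / x ^ 2) ≤ ∑ σ ∈ typicalSet n x, Us n σ := by
    rw [typicalSet, Finset.sum_filter]
    refine Finset.sum_le_sum fun σ _ => ?_
    have h0 := Us_nonneg n σ
    split_ifs with h
    · have : 0 ≤ rDev n σ ^ 2 / x ^ 2 := by positivity
      nlinarith
    · have : 1 ≤ rDev n σ ^ 2 / x ^ 2 := by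
        rw [le_div_iff₀ (by positivity), one_mul, ← sq_abs (rDev n σ)]
        exact pow_le_pow_left₀ hx.le (not_lt.1 h) 2
      nlinarith
  refine le_trans ?_ h1
  have h2 := sum_rDev_sq_le n hn
  have h3 : ∑ σ, Us n σ * (1 - rDev n σ ^ 2 / x ^ 2) =
      1 - (∑ σ, rDev n σ ^ 2) * ((n.factorial : ℝ)⁻¹ / x ^ 2) := by
    have h : ∀ σ, Us n σ * (1 - rDev n σ ^ 2 / x ^ 2) =
        Us n σ - rDev n σ ^ 2 * ((n.factorial : ℝ)⁻¹ / x ^ 2) := fun σ => by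
      simp only [Us]
      ring
    simp_rw [h, Finset.sum_sub_distrib, sum_Us, Finset.sum_mul]
  rw [h3]
  have h4 : (∑ σ, rDev n σ ^ 2) * ((n.factorial : ℝ)⁻¹ / x ^ 2) ≤
      (3 * n * n.factorial) * ((n.factorial : ℝ)⁻¹ / x ^ 2) :=
    mul_le_mul_of_nonneg_right h2 (by positivity)
  have h5 : (3 * n * n.factorial : ℝ) * ((n.factorial : ℝ)⁻¹ / x ^ 2) = 3 * n / x ^ 2 := by
    have : (n.factorial : ℝ) ≠ 0 := by positivity
    field_simp
  linarith

lemma Qs_eq_prod (n m : ℕ) (hm : 1 ≤ m) (σ : Equiv.Perm (Fin n)) (hr : rSeq n σ ≤ m) :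
    Qs n m σ = Us n σ *
      ∏ i ∈ Finset.range n, (1 + ((n : ℝ) - rSeq n σ - i) / m) := by
  have h := Nat.descFactorial_eq_factorial_mul_choose (n + m - rSeq n σ) n
  rw [Nat.descFactorial_eq_prod_range] at h
  have h' : (∏ i ∈ Finset.range n, ((m : ℝ) + (n - rSeq n σ - i))) =
      n.factorial * ((n + m - rSeq n σ).choose n : ℕ) := by
    rw [← Nat.cast_mul, ← h, Nat.cast_prod]
    refine Finset.prod_congr rfl fun i hi => ?_
    have := Finset.mem_range.1 hi
    rw [Nat.sub_sub, Nat.cast_sub (by omega)]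
    push_cast
    ring
  have hm0 : (m : ℝ) ≠ 0 := by positivity
  have h2 : ∏ i ∈ Finset.range n, (1 + ((n : ℝ) - rSeq n σ - i) / m) =
      ((m : ℝ) ^ n)⁻¹ * ∏ i ∈ Finset.range n, ((m : ℝ) + (n - rSeq n σ - i)) := by
    have hc : ∏ _i ∈ Finset.range n, (m : ℝ)⁻¹ = (m : ℝ)⁻¹ ^ n := by simp
    rw [← inv_pow, ← hc, ← Finset.prod_mul_distrib]
    refine Finset.prod_congr rfl fun i _ => ?_
    field_simp
  rw [h2, h', Qs, Us]
  have : (n.factorial : ℝ) ≠ 0 := by positivity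
  field_simp

lemma sum_shift (n : ℕ) (r : ℝ) :
    ∑ i ∈ Finset.range n, ((n : ℝ) - r - i) = -(n * (2 * r - n - 1)) / 2 := by
  have h : ∀ k : ℕ, ∑ i ∈ Finset.range k, (i : ℝ) = k * (k - 1) / 2 := by
    intro k
    induction k with
    | zero => simp
    | succ k ih => rw [Finset.sum_range_succ, ih]; push_cast; ring
  rw [Finset.sum_sub_distrib, h]
  simp
  ring

lemma sum_shift_sq (n : ℕ) (r : ℝ) :
    ∑ i ∈ Finset.range n, ((n : ℝ) - r - i) ^ 2 =
      n * (n ^ 2 - 1) / 12 + n * (2 * r - n - 1) ^ 2 / 4 := by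
  have h : ∀ (c : ℝ) (k : ℕ), ∑ i ∈ Finset.range k, (c - i) ^ 2 =
      k * c ^ 2 - c * (k * (k - 1)) + k * (k - 1) * (2 * k - 1) / 6 := by
    intro c k
    induction k with
    | zero => simp
    | succ k ih => rw [Finset.sum_range_succ, ih]; push_cast; ring
  rw [h]
  ring

lemma one_add_le_exp_sub_sq {y : ℝ} (h1 : -1 ≤ y) (h2 : y ≤ 2) :
    1 + y ≤ Real.exp (y - y ^ 2 / 8) := by
  have h3 := Real.add_one_le_exp (y / 2 - y ^ 2 / 16)
  have h4 : 0 ≤ y / 2 - y ^ 2 / 16 + 1 := by nlinarith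
  have h5 : Real.exp (y - y ^ 2 / 8) = Real.exp (y / 2 - y ^ 2 / 16) ^ 2 := by
    rw [← Real.exp_nat_mul]; congr 1; push_cast; ring
  rw [h5]
  refine le_trans ?_ (pow_le_pow_left₀ h4 h3 2)
  have h6 : 0 ≤ y ^ 2 * (1 / 8 - y / 16 + y ^ 2 / 256) := by
    refine mul_nonneg (sq_nonneg _) ?_
    nlinarith [sq_nonneg y]
  nlinarith

lemma exp_sub_sq_le_one_add {y : ℝ} (h1 : -(1 / 2) ≤ y) :
    Real.exp (y - 2 * y ^ 2) ≤ 1 + y := by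
  have hy : 0 < 1 + y := by linarith
  rw [← Real.le_log_iff_exp_le hy]
  refine le_trans ?_ (Real.one_sub_inv_le_log_of_pos hy)
  rw [show 1 - (1 + y)⁻¹ = y / (1 + y) by field_simp; ring, le_div_iff₀ hy]
  nlinarith [sq_nonneg y, mul_nonneg (sq_nonneg y) (show 0 ≤ 1 + 2 * y by linarith)]

lemma Qs_le_exp (n m : ℕ) (hn : 2 ≤ n) (hm : 1 ≤ m) (σ : Equiv.Perm (Fin n)) (x : ℝ)
    (hσ : σ ∈ typicalSet n x) (hx : x ≤ n / 3) :
    Qs n m σ ≤ Us n σ *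
      Real.exp (n * x / (2 * m) - (n : ℝ) ^ 3 / (128 * (m : ℝ) ^ 2)) := by
  have hd : |rDev n σ| < x := (Finset.mem_filter.1 hσ).2
  have hm0 : (0 : ℝ) < m := by exact_mod_cast hm
  have hn0 : (2 : ℝ) ≤ n := by exact_mod_cast hn
  by_cases hr : rSeq n σ ≤ m
  · rw [Qs_eq_prod n m hm σ hr]
    refine mul_le_mul_of_nonneg_left ?_ (Us_nonneg n σ)
    have hrm : (rSeq n σ : ℝ) ≤ m := by exact_mod_cast hr
    have hrn : (rSeq n σ : ℝ) ≤ n := by exact_mod_cast rSeq_le n (by omega) σ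
    have hdev : -x < rDev n σ := (abs_lt.1 hd).1
    have hr3 : (n : ℝ) / 3 ≤ rSeq n σ := by
      unfold rDev at hdev; linarith
    have hy : ∀ i ∈ Finset.range n, -1 ≤ ((n : ℝ) - rSeq n σ - i) / m ∧
        ((n : ℝ) - rSeq n σ - i) / m ≤ 2 := by
      intro i hi
      have hi' : (i : ℝ) + 1 ≤ n := by exact_mod_cast Finset.mem_range.1 hi
      have hi0 : (0 : ℝ) ≤ i := by positivity
      rw [le_div_iff₀ hm0, div_le_iff₀ hm0]
      constructor <;> linarith
    calc ∏ i ∈ Finset.range n, (1 + ((n : ℝ) - rSeq n σ - i) / m)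
        ≤ ∏ i ∈ Finset.range n, Real.exp (((n : ℝ) - rSeq n σ - i) / m -
          (((n : ℝ) - rSeq n σ - i) / m) ^ 2 / 8) :=
          Finset.prod_le_prod (fun i hi => by linarith [(hy i hi).1])
            fun i hi => one_add_le_exp_sub_sq (hy i hi).1 (hy i hi).2
      _ = Real.exp (-(n * rDev n σ) / 2 / m -
          (n * (n ^ 2 - 1) / 12 + n * rDev n σ ^ 2 / 4) / (8 * m ^ 2)) := by
          rw [← Real.exp_sum, rDev, ← sum_shift, ← sum_shift_sq, Finset.sum_sub_distrib,
            Finset.sum_div, Finset.sum_div]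
          congr 2
          refine Finset.sum_congr rfl fun i _ => ?_
          rw [div_pow, div_div, mul_comm (8 : ℝ)]
      _ ≤ _ := by
          rw [Real.exp_le_exp]
          refine sub_le_sub ?_ ?_
          · rw [div_div]
            refine div_le_div_of_nonneg_right ?_ (by positivity)
            nlinarith
          · rw [div_le_div_iff₀ (by positivity) (by positivity)]
            have h1 : (n : ℝ) ^ 3 / 128 * 8 ≤ n * (n ^ 2 - 1) / 12 := by nlinarith
            have h2 : 0 ≤ (n : ℝ) * rDev n σ ^ 2 / 4 := by positivity
            have h3 : 0 ≤ (m : ℝ) ^ 2 := by positivity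
            nlinarith
  · have : Qs n m σ = 0 := by
      rw [Qs, Nat.choose_eq_zero_of_lt (by omega)]
      simp
    rw [this]
    exact mul_nonneg (Us_nonneg n σ) (Real.exp_nonneg _)

lemma le_Qs (n m : ℕ) (hn : 1 ≤ n) (hm : 2 * n ≤ m) (σ : Equiv.Perm (Fin n)) (x : ℝ)
    (hσ : σ ∈ typicalSet n x) :
    Us n σ * (1 - (n * x / (2 * m) + 2 * (n : ℝ) ^ 3 / (m : ℝ) ^ 2)) ≤ Qs n m σ := by
  have hd : |rDev n σ| < x := (Finset.mem_filter.1 hσ).2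
  have hm0 : (0 : ℝ) < m := by exact_mod_cast (show 0 < m by omega)
  have hn0 : (1 : ℝ) ≤ n := by exact_mod_cast hn
  have hmn : 2 * (n : ℝ) ≤ m := by exact_mod_cast hm
  have hrn : (rSeq n σ : ℝ) ≤ n := by exact_mod_cast rSeq_le n hn σ
  have hr1 : 1 ≤ (rSeq n σ : ℝ) := by exact_mod_cast one_le_rSeq n σ
  rw [Qs_eq_prod n m (by omega) σ ((rSeq_le n hn σ).trans (by omega))]
  refine mul_le_mul_of_nonneg_left ?_ (Us_nonneg n σ)
  have hdev : rDev n σ < x := (abs_lt.1 hd).2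
  have hy : ∀ i ∈ Finset.range n, |(n : ℝ) - rSeq n σ - i| ≤ n := by
    intro i hi
    have hi' : (i : ℝ) + 1 ≤ n := by exact_mod_cast Finset.mem_range.1 hi
    have hi0 : (0 : ℝ) ≤ i := by positivity
    rw [abs_le]
    constructor <;> linarith
  calc 1 - (n * x / (2 * m) + 2 * (n : ℝ) ^ 3 / (m : ℝ) ^ 2)
      ≤ Real.exp (-(n * x / (2 * m) + 2 * (n : ℝ) ^ 3 / (m : ℝ) ^ 2)) :=
        Real.one_sub_le_exp_neg _
    _ ≤ Real.exp (-(n * rDev n σ) / 2 / m -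
        2 * (∑ i ∈ Finset.range n, ((n : ℝ) - rSeq n σ - i) ^ 2) / m ^ 2) := by
        rw [Real.exp_le_exp, neg_add, ← sub_eq_add_neg]
        refine sub_le_sub ?_ ?_
        · rw [div_div, ← neg_div]
          refine div_le_div_of_nonneg_right ?_ (by positivity)
          nlinarith
        · refine div_le_div_of_nonneg_right ?_ (by positivity)
          have : ∑ i ∈ Finset.range n, ((n : ℝ) - rSeq n σ - i) ^ 2 ≤
              ∑ i ∈ Finset.range n, (n : ℝ) ^ 2 :=
            Finset.sum_le_sum fun i hi => by
              rw [← sq_abs]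
              exact pow_le_pow_left₀ (abs_nonneg _) (hy i hi) 2
          rw [Finset.sum_const, Finset.card_range, nsmul_eq_mul] at this
          nlinarith
    _ = ∏ i ∈ Finset.range n, Real.exp (((n : ℝ) - rSeq n σ - i) / m -
          2 * (((n : ℝ) - rSeq n σ - i) / m) ^ 2) := by
        rw [← Real.exp_sum, rDev, ← sum_shift, Finset.sum_div, Finset.mul_sum,
          Finset.sum_div, ← Finset.sum_sub_distrib]
        congr 1
        refine Finset.sum_congr rfl fun i _ => ?_
        rw [div_pow, mul_div_assoc]
    _ ≤ _ := by
        refine Finset.prod_le_prod (fun i _ => Real.exp_nonneg _) fun i hi =>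
          exp_sub_sq_le_one_add ?_
        have := (abs_le.1 (hy i hi)).1
        rw [le_div_iff₀ hm0]
        linarith

/-- The expectation of `f` at the product of `k` independent variables with distribution `p`. -/
def mixExp (p : ℕ → ℝ) : ℕ → (ℕ → ℝ) → ℝ
  | 0, f => f 1
  | k + 1, f => ∑' a : ℕ, p a * mixExp p k fun b => f (a * b)

section mixExp

variable {p : ℕ → ℝ} {f g : ℕ → ℝ} {C D : ℝ}

lemma abs_mixExp_le (hp0 : ∀ a, 0 ≤ p a) (hp : HasSum p 1) (k : ℕ) :
    ∀ f : ℕ → ℝ, (∀ m, |f m| ≤ C) → |mixExp p k f| ≤ C := by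
  induction k with
  | zero => intro f hf; exact hf 1
  | succ k ih =>
    intro f hf
    have h := hp.mul_right C
    rw [one_mul] at h
    rw [mixExp, ← Real.norm_eq_abs]
    refine tsum_of_norm_bounded h fun a => ?_
    rw [Real.norm_eq_abs, abs_mul, abs_of_nonneg (hp0 a)]
    exact mul_le_mul_of_nonneg_left (ih _ fun b => hf _) (hp0 a)

lemma summable_mul_bounded (hp0 : ∀ a, 0 ≤ p a) (hp : HasSum p 1) (hf : ∀ m, |f m| ≤ C) :
    Summable fun a => p a * f a := by
  refine Summable.of_norm_bounded (hp.summable.mul_right C) fun a => ?_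
  rw [Real.norm_eq_abs, abs_mul, abs_of_nonneg (hp0 a)]
  exact mul_le_mul_of_nonneg_left (hf a) (hp0 a)

lemma summable_mixExp (hp0 : ∀ a, 0 ≤ p a) (hp : HasSum p 1) (k : ℕ) (hf : ∀ m, |f m| ≤ C) :
    Summable fun a => p a * mixExp p k fun b => f (a * b) :=
  summable_mul_bounded hp0 hp fun _ => abs_mixExp_le hp0 hp k _ fun _ => hf _

lemma mixExp_const (hp : HasSum p 1) (k : ℕ) (c : ℝ) : mixExp p k (fun _ => c) = c := by
  induction k with
  | zero => rfl
  | succ k ih => rw [mixExp, ih, tsum_mul_right, hp.tsum_eq, one_mul]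

lemma mixExp_const_mul (k : ℕ) (c : ℝ) :
    ∀ f : ℕ → ℝ, mixExp p k (fun m => c * f m) = c * mixExp p k f := by
  induction k with
  | zero => intro f; rfl
  | succ k ih =>
    intro f
    simp only [mixExp]
    rw [← tsum_mul_left]
    refine tsum_congr fun a => ?_
    rw [ih fun b => f (a * b)]
    ring

lemma mixExp_add (hp0 : ∀ a, 0 ≤ p a) (hp : HasSum p 1) (k : ℕ) :
    ∀ f g : ℕ → ℝ, (∀ m, |f m| ≤ C) → (∀ m, |g m| ≤ D) →
      mixExp p k (fun m => f m + g m) = mixExp p k f + mixExp p k g := by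
  induction k with
  | zero => intro f g _ _; rfl
  | succ k ih =>
    intro f g hf hg
    simp only [mixExp]
    rw [← (summable_mixExp hp0 hp k hf).tsum_add (summable_mixExp hp0 hp k hg)]
    refine tsum_congr fun a => ?_
    rw [ih (fun b => f (a * b)) (fun b => g (a * b)) (fun b => hf _) fun b => hg _]
    ring

lemma mixExp_sum {ι : Type*} (hp0 : ∀ a, 0 ≤ p a) (hp : HasSum p 1) (k : ℕ) (s : Finset ι)
    (F : ι → ℕ → ℝ) (hF : ∀ i m, |F i m| ≤ C) :
    mixExp p k (fun m => ∑ i ∈ s, F i m) = ∑ i ∈ s, mixExp p k (F i) := by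
  classical
  induction s using Finset.induction_on with
  | empty => simpa using mixExp_const hp k 0
  | insert i s hi ih =>
    simp only [Finset.sum_insert hi]
    rw [mixExp_add (C := C) (D := ∑ _i ∈ s, C) hp0 hp k (F i) _ (hF i), ih]
    intro m
    exact (Finset.abs_sum_le_sum_abs _ _).trans (Finset.sum_le_sum fun i _ => hF i m)

lemma mixExp_mono (hp0 : ∀ a, 0 ≤ p a) (hpz : p 0 = 0) (hp : HasSum p 1) (k : ℕ) :
    ∀ f g : ℕ → ℝ, (∀ m, |f m| ≤ C) → (∀ m, |g m| ≤ D) → (∀ m, 1 ≤ m → f m ≤ g m) →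
      mixExp p k f ≤ mixExp p k g := by
  induction k with
  | zero => intro f g _ _ h; exact h 1 le_rfl
  | succ k ih =>
    intro f g hf hg h
    refine (summable_mixExp hp0 hp k hf).tsum_le_tsum (fun a => ?_) (summable_mixExp hp0 hp k hg)
    rcases Nat.eq_zero_or_pos a with rfl | ha
    · simp [hpz]
    · exact mul_le_mul_of_nonneg_left (ih _ _ (fun b => hf _) (fun b => hg _)
        fun b hb => h _ (Nat.mul_pos ha hb)) (hp0 a)

lemma iterConv_Qp_eq_mixExp (hp0 : ∀ a, 0 ≤ p a) (hp : HasSum p 1) (n : ℕ) (hn : 1 ≤ n)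
    (k : ℕ) :
    ∀ σ, iterConv n (Qp n p) k σ = mixExp p k fun m => Qs n m σ := by
  have hQ : ∀ σ m, |Qs n m σ| ≤ 1 := fun σ m => by
    rw [abs_of_nonneg (Qs_nonneg n m σ)]
    exact Qs_le_one n m hn σ
  induction k with
  | zero => intro σ; rw [iterConv, mixExp, Qs_one n hn]
  | succ k ih =>
    intro σ
    rw [iterConv, convol, mixExp]
    have h1 : ∀ a, mixExp p k (fun b => Qs n (a * b) σ) =
        ∑ τ, Qs n a (σ * τ⁻¹) * mixExp p k fun b => Qs n b τ := by
      intro a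
      simp_rw [← convol_Qs n a _ hn σ]
      rw [mixExp_sum (C := 1) hp0 hp]
      · exact Finset.sum_congr rfl fun τ _ => mixExp_const_mul k _ _
      · intro τ b
        rw [abs_mul]
        exact mul_le_one₀ (hQ _ _) (abs_nonneg _) (hQ _ _)
    simp_rw [h1, ih, Qp, Finset.mul_sum, ← mul_assoc]
    rw [Summable.tsum_finsetSum fun τ _ =>
      (summable_mul_bounded hp0 hp fun a => hQ (σ * τ⁻¹) a).mul_right _]
    simp_rw [tsum_mul_right]

lemma abs_ite_one_le (P : Prop) [Decidable P] : |if P then (1 : ℝ) else 0| ≤ 1 := by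
  split_ifs <;> simp

lemma mixExp_lower_tail (hp0 : ∀ a, 0 ≤ p a) (hpz : p 0 = 0) (hp : HasSum p 1) {l : ℝ}
    (hl : 0 ≤ l) (k : ℕ) :
    ∀ x : ℝ, mixExp p k (fun m => if (m : ℝ) < Real.exp x then 1 else 0) ≤
      Real.exp (l * x) * (∑' a : ℕ, p a * Real.exp (-l * Real.log a)) ^ k := by
  set G := ∑' a : ℕ, p a * Real.exp (-l * Real.log a) with hG
  have hsum : Summable fun a : ℕ => p a * Real.exp (-l * Real.log a) := by
    refine summable_mul_bounded (C := 1) hp0 hp fun a => ?_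
    rw [abs_of_nonneg (Real.exp_nonneg _), Real.exp_le_one_iff]
    have := Real.log_natCast_nonneg a
    nlinarith
  induction k with
  | zero =>
    intro x
    rw [mixExp, pow_zero, mul_one]
    split_ifs with h
    · rw [Nat.cast_one, Real.one_lt_exp_iff] at h
      exact Real.one_le_exp (by positivity)
    · exact Real.exp_nonneg _
  | succ k ih =>
    intro x
    rw [mixExp]
    have h : ∀ a : ℕ, p a * mixExp p k
        (fun b => if ((a * b : ℕ) : ℝ) < Real.exp x then 1 else 0) ≤
        p a * Real.exp (-l * Real.log a) * (Real.exp (l * x) * G ^ k) := by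
      intro a
      rcases Nat.eq_zero_or_pos a with rfl | ha
      · simp [hpz]
      have ha' : (0 : ℝ) < a := by exact_mod_cast ha
      have he : ∀ b : ℕ, ((a * b : ℕ) : ℝ) < Real.exp x ↔
          (b : ℝ) < Real.exp (x - Real.log a) := by
        intro b
        rw [Real.exp_sub, Real.exp_log ha', lt_div_iff₀' ha', Nat.cast_mul]
      simp_rw [he]
      refine (mul_le_mul_of_nonneg_left (ih (x - Real.log a)) (hp0 a)).trans_eq ?_
      rw [mul_sub, sub_eq_add_neg, Real.exp_add, neg_mul]
      ring
    have hs := summable_mixExp (C := 1) (f := fun m : ℕ => if (m : ℝ) < Real.exp x then (1 : ℝ) else 0)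
      hp0 hp k fun m => abs_ite_one_le _
    refine (hs.tsum_le_tsum h
      (hsum.mul_right _)).trans_eq ?_
    rw [tsum_mul_right, ← hG]
    ring

lemma mixExp_upper_tail (hp0 : ∀ a, 0 ≤ p a) (hpz : p 0 = 0) (hp : HasSum p 1) {l y : ℝ}
    (hl : 0 ≤ l) (k : ℕ) :
    ∀ x : ℝ, mixExp p k (fun m => if Real.exp x ≤ (m : ℝ) then 1 else 0) ≤
      k * (∑' a : ℕ, p a * if y < Real.log a then 1 else 0) +
      Real.exp (-l * x) *
        (∑' a : ℕ, p a * if y < Real.log a then 0 else Real.exp (l * Real.log a)) ^ k := by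
  set G := ∑' a : ℕ, p a * if y < Real.log a then 0 else Real.exp (l * Real.log a) with hG
  set q := ∑' a : ℕ, p a * if y < Real.log a then (1 : ℝ) else 0 with hq
  have hsum : Summable fun a : ℕ =>
      p a * if y < Real.log a then 0 else Real.exp (l * Real.log a) := by
    refine summable_mul_bounded (C := Real.exp (l * y)) hp0 hp fun a => ?_
    split_ifs with h
    · rw [abs_zero]; exact Real.exp_nonneg _
    · rw [abs_of_nonneg (Real.exp_nonneg _), Real.exp_le_exp]
      exact mul_le_mul_of_nonneg_left (not_lt.1 h) hl
  have hsumq : Summable fun a : ℕ => p a * if y < Real.log a then (1 : ℝ) else 0 :=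
    summable_mul_bounded (C := 1) hp0 hp fun a => abs_ite_one_le _
  have hG0 : 0 ≤ G := tsum_nonneg fun a => mul_nonneg (hp0 a) (by
    split_ifs
    · exact le_rfl
    · exact Real.exp_nonneg _)
  have hq0 : 0 ≤ q := tsum_nonneg fun a => mul_nonneg (hp0 a) (by split_ifs <;> simp)
  induction k with
  | zero =>
    intro x
    rw [mixExp, pow_zero, mul_one, Nat.cast_zero, zero_mul, zero_add]
    split_ifs with h
    · rw [Nat.cast_one, Real.exp_le_one_iff] at h
      exact Real.one_le_exp (by nlinarith)
    · exact Real.exp_nonneg _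
  | succ k ih =>
    intro x
    rw [mixExp]
    have h : ∀ a : ℕ, p a * mixExp p k
        (fun b => if Real.exp x ≤ ((a * b : ℕ) : ℝ) then 1 else 0) ≤
        (p a * if y < Real.log a then 1 else 0) + p a * (k * q) +
        (p a * if y < Real.log a then 0 else Real.exp (l * Real.log a)) *
          (Real.exp (-l * x) * G ^ k) := by
      intro a
      rcases Nat.eq_zero_or_pos a with rfl | ha
      · simp [hpz]
      have ha' : (0 : ℝ) < a := by exact_mod_cast ha
      split_ifs with hy
      · have h1 := (abs_le.1 (abs_mixExp_le (C := 1) hp0 hp k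
          (fun b => if Real.exp x ≤ ((a * b : ℕ) : ℝ) then 1 else 0)
          fun b => abs_ite_one_le _)).2
        have h2 : 0 ≤ p a * (k * q) := mul_nonneg (hp0 a) (by positivity)
        have h3 := mul_le_mul_of_nonneg_left h1 (hp0 a)
        linarith
      · have he : ∀ b : ℕ, Real.exp x ≤ ((a * b : ℕ) : ℝ) ↔
            Real.exp (x - Real.log a) ≤ (b : ℝ) := by
          intro b
          rw [Real.exp_sub, Real.exp_log ha', div_le_iff₀' ha', Nat.cast_mul]
        simp_rw [he]
        refine (mul_le_mul_of_nonneg_left (ih (x - Real.log a)) (hp0 a)).trans_eq ?_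
        rw [mul_sub, sub_eq_add_neg, Real.exp_add, neg_mul l (Real.log a), neg_neg]
        ring
    have hs := summable_mixExp (C := 1) (f := fun m : ℕ => if Real.exp x ≤ (m : ℝ) then (1 : ℝ) else 0)
      hp0 hp k fun m => abs_ite_one_le _
    refine (hs.tsum_le_tsum h
      ((hsumq.add (hp.summable.mul_right _)).add (hsum.mul_right _))).trans_eq ?_
    rw [(hsumq.add (hp.summable.mul_right _)).tsum_add (hsum.mul_right _),
      hsumq.tsum_add (hp.summable.mul_right _), tsum_mul_right, tsum_mul_right, ← hG, ← hq,
      hp.tsum_eq]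
    push_cast
    ring

end mixExp

section totalVariation

variable {n : ℕ} {μ ν : Equiv.Perm (Fin n) → ℝ}

lemma tv_le_of_minorized (hμ0 : ∀ σ, 0 ≤ μ σ) (hν0 : ∀ σ, 0 ≤ ν σ) (hμ : ∑ σ, μ σ = 1)
    (hν : ∑ σ, ν σ = 1) (B : Finset (Equiv.Perm (Fin n))) {c : ℝ} (hc : c ≤ 1)
    (hB : ∀ σ ∈ B, c * ν σ ≤ μ σ) : tv n μ ν ≤ 1 - c * ∑ σ ∈ B, ν σ := by
  classical
  have h : ∀ σ, |μ σ - ν σ| ≤ μ σ - ν σ + 2 * (ν σ - if σ ∈ B then c * ν σ else 0) := by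
    intro σ
    have h0 := hμ0 σ
    have h1 := hν0 σ
    split_ifs with hσ
    · have h2 := hB σ hσ
      have h3 : c * ν σ ≤ ν σ := mul_le_of_le_one_left h1 hc
      rw [abs_le]
      constructor <;> linarith
    · rw [abs_le]
      constructor <;> linarith
  have hs := Finset.sum_le_sum fun σ (_ : σ ∈ Finset.univ) => h σ
  rw [Finset.sum_add_distrib, Finset.sum_sub_distrib, ← Finset.mul_sum, Finset.sum_sub_distrib,
    hμ, hν, Finset.sum_ite_mem, Finset.univ_inter, ← Finset.mul_sum] at hs
  rw [tv]
  linarith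

lemma sub_le_tv (hμ : ∑ σ, μ σ = 1) (hν : ∑ σ, ν σ = 1) (B : Finset (Equiv.Perm (Fin n))) :
    ∑ σ ∈ B, ν σ - ∑ σ ∈ B, μ σ ≤ tv n μ ν := by
  classical
  have h : ∀ σ, 2 * (if σ ∈ B then ν σ - μ σ else 0) ≤ |μ σ - ν σ| + (ν σ - μ σ) := by
    intro σ
    have h1 := neg_abs_le (μ σ - ν σ)
    have h2 := le_abs_self (μ σ - ν σ)
    split_ifs <;> linarith
  have hs := Finset.sum_le_sum fun σ (_ : σ ∈ Finset.univ) => h σ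
  rw [Finset.sum_add_distrib, ← Finset.mul_sum, Finset.sum_sub_distrib, Finset.sum_ite_mem,
    Finset.univ_inter, hμ, hν, Finset.sum_sub_distrib] at hs
  rw [tv]
  linarith

end totalVariation

section mixedShuffle

variable {p : ℕ → ℝ} {n : ℕ}

lemma abs_Qs_le_one (hn : 1 ≤ n) (σ : Equiv.Perm (Fin n)) (m : ℕ) : |Qs n m σ| ≤ 1 := by
  rw [abs_of_nonneg (Qs_nonneg n m σ)]
  exact Qs_le_one n m hn σ

lemma iterConv_Qp_nonneg (hp0 : ∀ a, 0 ≤ p a) (hpz : p 0 = 0) (hp : HasSum p 1) (hn : 1 ≤ n)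
    (k : ℕ) (σ : Equiv.Perm (Fin n)) : 0 ≤ iterConv n (Qp n p) k σ := by
  rw [iterConv_Qp_eq_mixExp hp0 hp n hn, ← mixExp_const hp k 0]
  exact mixExp_mono (C := 0) (D := 1) hp0 hpz hp k _ _ (by simp) (abs_Qs_le_one hn σ)
    fun m _ => Qs_nonneg n m σ

lemma sum_iterConv_Qp (hp0 : ∀ a, 0 ≤ p a) (hpz : p 0 = 0) (hp : HasSum p 1) (hn : 1 ≤ n)
    (k : ℕ) : ∑ σ, iterConv n (Qp n p) k σ = 1 := by
  simp_rw [iterConv_Qp_eq_mixExp hp0 hp n hn]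
  rw [← mixExp_sum (C := 1) hp0 hp k Finset.univ (fun σ m => Qs n m σ) (abs_Qs_le_one hn)]
  have hb : ∀ m, |∑ σ, Qs n m σ| ≤ 1 := fun m => by
    rw [abs_of_nonneg (Finset.sum_nonneg fun σ _ => Qs_nonneg n m σ)]
    exact sum_Qs_le_one n m hn _
  have hc : ∀ _ : ℕ, |(1 : ℝ)| ≤ 1 := by simp
  have h1 := mixExp_const hp k 1
  refine le_antisymm ?_ ?_
  · rw [← h1]
    exact mixExp_mono hp0 hpz hp k _ _ hb hc fun m hm => (sum_Qs n m hn hm).le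
  · rw [← h1]
    exact mixExp_mono hp0 hpz hp k _ _ hc hb fun m hm => (sum_Qs n m hn hm).ge

lemma tv_iterConv_Qp_le_one (hp0 : ∀ a, 0 ≤ p a) (hpz : p 0 = 0) (hp : HasSum p 1)
    (hn : 1 ≤ n) (k : ℕ) : tv n (iterConv n (Qp n p) k) (Us n) ≤ 1 := by
  simpa using tv_le_of_minorized (iterConv_Qp_nonneg hp0 hpz hp hn k) (Us_nonneg n)
    (sum_iterConv_Qp hp0 hpz hp hn k) (sum_Us n) ∅ (c := 0) zero_le_one

lemma tv_iterConv_Qp_le (hp0 : ∀ a, 0 ≤ p a) (hpz : p 0 = 0) (hp : HasSum p 1) (hn : 1 ≤ n)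
    (k : ℕ) {x X : ℝ} (hx : 0 < x) (hX : 2 * n ≤ Real.exp X) :
    tv n (iterConv n (Qp n p) k) (Us n) ≤
      mixExp p k (fun m => if (m : ℝ) < Real.exp X then 1 else 0) + 3 * n / x ^ 2 +
      (n * x / (2 * Real.exp X) + 2 * (n : ℝ) ^ 3 / Real.exp X ^ 2) := by
  set P := mixExp p k fun m => if (m : ℝ) < Real.exp X then 1 else 0 with hP
  set e := n * x / (2 * Real.exp X) + 2 * (n : ℝ) ^ 3 / Real.exp X ^ 2 with he
  have hind : ∀ m : ℕ, |if (m : ℝ) < Real.exp X then (1 : ℝ) else 0| ≤ 1 :=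
    fun m => abs_ite_one_le _
  have hP1 : P ≤ 1 := (abs_le.1 (abs_mixExp_le hp0 hp k _ hind)).2
  have hP0 : 0 ≤ P := by
    rw [← mixExp_const hp k 0, hP]
    exact mixExp_mono (C := 0) hp0 hpz hp k _ _ (by simp) hind fun m _ => by
      split_ifs <;> simp
  have he0 : 0 ≤ e := by positivity
  have hd0 : 0 ≤ 3 * n / x ^ 2 := by positivity
  by_cases he1 : 1 < e
  · linarith [tv_iterConv_Qp_le_one hp0 hpz hp hn k]
  rw [not_lt] at he1
  have hB : ∀ σ ∈ typicalSet n x, ((1 - e) * (1 - P)) * Us n σ ≤ iterConv n (Qp n p) k σ := by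
    intro σ hσ
    rw [iterConv_Qp_eq_mixExp hp0 hp n hn]
    have h1 : ((1 - e) * (1 - P)) * Us n σ = mixExp p k fun m =>
        ((1 - e) * Us n σ) + (-((1 - e) * Us n σ)) *
          if (m : ℝ) < Real.exp X then 1 else 0 := by
      rw [mixExp_add (C := |(1 - e) * Us n σ|) (D := |(1 - e) * Us n σ|) hp0 hp k _ _
        (fun _ => le_rfl), mixExp_const hp, mixExp_const_mul, ← hP]
      · ring
      · intro m
        rw [abs_mul, abs_neg]
        exact mul_le_of_le_one_right (abs_nonneg _) (hind m)
    rw [h1]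
    have hc0 : 0 ≤ (1 - e) * Us n σ := mul_nonneg (by linarith) (Us_nonneg n σ)
    refine mixExp_mono (C := (1 - e) * Us n σ) (D := 1) hp0 hpz hp k _ _ ?_
      (abs_Qs_le_one hn σ) ?_
    · intro m
      split_ifs
      · simpa using hc0
      · simp [abs_of_nonneg hc0]
    · intro m hm
      split_ifs with h
      · simpa using Qs_nonneg n m σ
      · rw [not_lt] at h
        have hm2 : 2 * n ≤ m := by exact_mod_cast hX.trans h
        refine le_trans ?_ (le_Qs n m hn hm2 σ x hσ)
        rw [mul_zero, add_zero, mul_comm]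
        refine mul_le_mul_of_nonneg_left ?_ (Us_nonneg n σ)
        rw [he]
        gcongr
  have hc1 : (1 - e) * (1 - P) ≤ 1 := mul_le_one₀ (by linarith) (by linarith) (by linarith)
  have hc0 : 0 ≤ (1 - e) * (1 - P) := mul_nonneg (by linarith) (by linarith)
  have h1 := tv_le_of_minorized (iterConv_Qp_nonneg hp0 hpz hp hn k) (Us_nonneg n)
    (sum_iterConv_Qp hp0 hpz hp hn k) (sum_Us n) _ hc1 hB
  have h2 := mul_le_mul_of_nonneg_left (sum_Us_typicalSet n hn x hx) hc0
  nlinarith [mul_nonneg he0 hP0]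

lemma le_tv_iterConv_Qp (hp0 : ∀ a, 0 ≤ p a) (hpz : p 0 = 0) (hp : HasSum p 1) (hn : 2 ≤ n)
    (k : ℕ) {x X e : ℝ} (hx : 0 < x) (hxn : x ≤ n / 3)
    (he : ∀ m : ℕ, 1 ≤ m → (m : ℝ) < Real.exp X →
      Real.exp (n * x / (2 * m) - (n : ℝ) ^ 3 / (128 * (m : ℝ) ^ 2)) ≤ e) (he0 : 0 ≤ e) :
    1 - 3 * n / x ^ 2 - e - mixExp p k (fun m => if Real.exp X ≤ (m : ℝ) then 1 else 0) ≤
      tv n (iterConv n (Qp n p) k) (Us n) := by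
  have hn1 : 1 ≤ n := by omega
  refine le_trans ?_ (sub_le_tv (sum_iterConv_Qp hp0 hpz hp hn1 k) (sum_Us n) (typicalSet n x))
  have hind : ∀ m : ℕ, |if Real.exp X ≤ (m : ℝ) then (1 : ℝ) else 0| ≤ 1 :=
    fun m => abs_ite_one_le _
  have h1 : ∑ σ ∈ typicalSet n x, iterConv n (Qp n p) k σ ≤
      e + mixExp p k (fun m => if Real.exp X ≤ (m : ℝ) then 1 else 0) := by
    simp_rw [iterConv_Qp_eq_mixExp hp0 hp n hn1]
    rw [← mixExp_sum (C := 1) hp0 hp k _ (fun σ m => Qs n m σ) (abs_Qs_le_one hn1)]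
    have h2 := mixExp_add (C := |e|) hp0 hp k (fun _ => e) _ (fun _ => le_rfl) hind
    rw [mixExp_const hp] at h2
    rw [← h2]
    refine mixExp_mono (C := 1) (D := |e| + 1) hp0 hpz hp k _ _ ?_ ?_ ?_
    · intro m
      rw [abs_of_nonneg (Finset.sum_nonneg fun σ _ => Qs_nonneg n m σ)]
      exact sum_Qs_le_one n m hn1 _
    · intro m
      exact (abs_add_le _ _).trans (add_le_add_right (hind m) _)
    · intro m hm
      split_ifs with h
      · linarith [sum_Qs_le_one n m hn1 (typicalSet n x)]
      · rw [not_le] at h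
        rw [add_zero]
        calc ∑ σ ∈ typicalSet n x, Qs n m σ ≤ ∑ σ ∈ typicalSet n x, Us n σ * e :=
              Finset.sum_le_sum fun σ hσ => (Qs_le_exp n m hn hm σ x hσ hxn).trans
                (mul_le_mul_of_nonneg_left (he m hm h) (Us_nonneg n σ))
          _ ≤ ∑ σ, Us n σ * e := Finset.sum_le_univ_sum_of_nonneg fun σ =>
              mul_nonneg (Us_nonneg n σ) he0
          _ = e := by rw [← Finset.sum_mul, sum_Us, one_mul]
  linarith [sum_Us_typicalSet n hn1 x hx]

end mixedShuffle

section laplace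

variable {p : ℕ → ℝ} {μ L K ε : ℝ}

lemma summable_mul_ite_log (hsum : Summable fun a : ℕ => p a * Real.log a) (y : ℝ) :
    Summable fun a : ℕ => p a * if y < Real.log a then Real.log a else 0 := by
  refine (hsum.indicator {a : ℕ | y < Real.log a}).congr fun a => ?_
  by_cases h : y < Real.log a <;> simp [h]

lemma laplace_neg_le (hp0 : ∀ a, 0 ≤ p a) (hp : HasSum p 1)
    (hμ : HasSum (fun a : ℕ => p a * Real.log a) μ) {l y ρ : ℝ} (hl : 0 ≤ l)
    (hρ1 : ρ ≤ 1) (hly : l * y ≤ 2 * ρ)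
    (hT : ∑' a : ℕ, p a * (if y < Real.log a then Real.log a else 0) ≤ ρ * μ) :
    ∑' a : ℕ, p a * Real.exp (-l * Real.log a) ≤ Real.exp (-((1 - ρ) ^ 2 * l * μ)) := by
  have hTs := summable_mul_ite_log hμ.summable y
  set T := ∑' a : ℕ, p a * (if y < Real.log a then Real.log a else 0)
  have h : ∀ a : ℕ, p a * Real.exp (-l * Real.log a) ≤ p a - ((1 - ρ) * l) *
      (p a * Real.log a - p a * (if y < Real.log a then Real.log a else 0)) := by
    intro a
    have hlog := Real.log_natCast_nonneg a
    have ht0 : 0 ≤ l * Real.log a := mul_nonneg hl hlog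
    split_ifs with hy
    · have : Real.exp (-l * Real.log a) ≤ 1 := Real.exp_le_one_iff.2 (by linarith)
      nlinarith [hp0 a]
    · have ht : l * Real.log a ≤ 2 * ρ :=
        (mul_le_mul_of_nonneg_left (not_lt.1 hy) hl).trans hly
      have hq := Real.quadratic_le_exp_of_nonneg ht0
      have hexp : Real.exp (-l * Real.log a) * Real.exp (l * Real.log a) = 1 := by
        rw [← Real.exp_add, neg_mul, neg_add_cancel, Real.exp_zero]
      set t := l * Real.log a
      have hb : Real.exp (-l * Real.log a) ≤ 1 - t + t ^ 2 / 2 := by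
        have h1 : 0 ≤ 1 - t + t ^ 2 / 2 := by nlinarith [sq_nonneg (t - 1)]
        have h2 := mul_le_mul_of_nonneg_left hq h1
        have h3 : 0 < Real.exp t := Real.exp_pos t
        have h4 : 1 ≤ (1 - t + t ^ 2 / 2) * Real.exp t := by nlinarith [sq_nonneg (t ^ 2)]
        exact le_of_mul_le_mul_right (hexp.le.trans h4) h3
      have hb2 : Real.exp (-l * Real.log a) ≤ 1 - (1 - ρ) * t := by nlinarith
      have := mul_le_mul_of_nonneg_left hb2 (hp0 a)
      calc _ ≤ _ := this
        _ = _ := by simp only [t]; ring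
  have hrs : HasSum (fun a : ℕ => p a - ((1 - ρ) * l) *
      (p a * Real.log a - p a * (if y < Real.log a then Real.log a else 0)))
      (1 - ((1 - ρ) * l) * (μ - T)) :=
    hp.sub ((hμ.sub hTs.hasSum).mul_left _)
  have hls : Summable fun a : ℕ => p a * Real.exp (-l * Real.log a) :=
    summable_mul_bounded (C := 1) hp0 hp fun a => by
      rw [abs_of_nonneg (Real.exp_nonneg _), Real.exp_le_one_iff]
      have := Real.log_natCast_nonneg a
      nlinarith
  refine (hls.tsum_le_tsum h hrs.summable).trans ?_
  rw [hrs.tsum_eq]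
  refine le_trans ?_ (Real.one_sub_le_exp_neg _)
  have : (1 - ρ) * l * ((1 - ρ) * μ) ≤ (1 - ρ) * l * (μ - T) :=
    mul_le_mul_of_nonneg_left (by linarith) (mul_nonneg (by linarith) hl)
  nlinarith

lemma laplace_truncated_le (hp0 : ∀ a, 0 ≤ p a) (hp : HasSum p 1)
    (hμ : HasSum (fun a : ℕ => p a * Real.log a) μ) {l y : ℝ} (hl : 0 ≤ l) :
    ∑' a : ℕ, p a * (if y < Real.log a then 0 else Real.exp (l * Real.log a)) ≤
      Real.exp (Real.exp (l * y) * l * μ) := by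
  have h : ∀ a : ℕ, p a * (if y < Real.log a then 0 else Real.exp (l * Real.log a)) ≤
      p a + (Real.exp (l * y) * l) * (p a * Real.log a) := by
    intro a
    have hlog := Real.log_natCast_nonneg a
    have ht0 : 0 ≤ l * Real.log a := mul_nonneg hl hlog
    have hE := Real.exp_pos (l * y)
    split_ifs with hy
    · have := mul_nonneg hE.le (mul_nonneg ht0 (hp0 a))
      nlinarith [hp0 a]
    · have h1 : Real.exp (l * Real.log a) ≤ Real.exp (l * y) :=
        Real.exp_le_exp.2 (mul_le_mul_of_nonneg_left (not_lt.1 hy) hl)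
      have h2 := Real.one_sub_le_exp_neg (l * Real.log a)
      have h3 := mul_le_mul_of_nonneg_right h2 (Real.exp_pos (l * Real.log a)).le
      rw [← Real.exp_add, neg_add_cancel, Real.exp_zero] at h3
      have h4 : Real.exp (l * Real.log a) ≤ 1 + l * Real.log a * Real.exp (l * y) := by
        nlinarith
      calc _ ≤ _ := mul_le_mul_of_nonneg_left h4 (hp0 a)
        _ = _ := by ring
  have hrs := hp.add (hμ.mul_left (Real.exp (l * y) * l))
  have hls : Summable fun a : ℕ =>
      p a * (if y < Real.log a then 0 else Real.exp (l * Real.log a)) :=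
    Summable.of_nonneg_of_le (fun a => mul_nonneg (hp0 a) (by
      split_ifs
      · exact le_rfl
      · exact Real.exp_nonneg _)) h hrs.summable
  refine (hls.tsum_le_tsum h hrs.summable).trans ?_
  rw [hrs.tsum_eq, add_comm]
  exact Real.add_one_le_exp _

lemma mul_tsum_ite_le (hp0 : ∀ a, 0 ≤ p a) (hp : HasSum p 1)
    (hsum : Summable fun a : ℕ => p a * Real.log a) (y : ℝ) :
    y * ∑' a : ℕ, p a * (if y < Real.log a then 1 else 0) ≤
      ∑' a : ℕ, p a * (if y < Real.log a then Real.log a else 0) := by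
  rw [← tsum_mul_left]
  refine Summable.tsum_le_tsum (fun a => ?_)
    ((summable_mul_bounded (C := 1) hp0 hp fun a => abs_ite_one_le _).mul_left _)
    (summable_mul_ite_log hsum y)
  split_ifs with h
  · nlinarith [hp0 a]
  · simp

lemma mixExp_lower_tail_le (hp0 : ∀ a, 0 ≤ p a) (hpz : p 0 = 0) (hp : HasSum p 1)
    (hμ : HasSum (fun a : ℕ => p a * Real.log a) μ) (hμ0 : 0 < μ) (hL : 0 < L) (hK : 0 < K)
    (hε0 : 0 < ε) (hε1 : ε < 1) {k : ℕ} (hk : (1 + ε) * (3 * L / (2 * μ)) < k)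
    (hT : ∑' a : ℕ, p a * (if ε / (8 * K) * L < Real.log a then Real.log a else 0) ≤
      ε / 16 * μ) :
    mixExp p k (fun m => if (m : ℝ) < Real.exp ((3 / 2 + ε / 4) * L) then 1 else 0) ≤
      Real.exp (-(ε / 2 * K)) := by
  have hl : 0 ≤ K / L := by positivity
  have hG := laplace_neg_le hp0 hp hμ hl (ρ := ε / 16) (by linarith)
    (by rw [show K / L * (ε / (8 * K) * L) = ε / 8 by field_simp]; linarith) hT
  refine (mixExp_lower_tail hp0 hpz hp hl k _).trans ?_
  have hG0 : 0 ≤ ∑' a : ℕ, p a * Real.exp (-(K / L) * Real.log a) :=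
    tsum_nonneg fun a => mul_nonneg (hp0 a) (Real.exp_nonneg _)
  refine (mul_le_mul_of_nonneg_left (pow_le_pow_left₀ hG0 hG k) (Real.exp_nonneg _)).trans ?_
  rw [← Real.exp_nat_mul, ← Real.exp_add, Real.exp_le_exp]
  have hkμ : (1 + ε) * (3 / 2) ≤ k * μ / L := by
    rw [le_div_iff₀ hL]
    have := mul_lt_mul_of_pos_right hk hμ0
    rw [show (1 + ε) * (3 * L / (2 * μ)) * μ = (1 + ε) * (3 / 2) * L by field_simp] at this
    exact this.le
  rw [show K / L * ((3 / 2 + ε / 4) * L) = (3 / 2 + ε / 4) * K by field_simp,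
    show (k : ℝ) * -((1 - ε / 16) ^ 2 * (K / L) * μ) =
      -((1 - ε / 16) ^ 2 * (k * μ / L) * K) by ring]
  have h1 : (1 - ε / 16) ^ 2 * ((1 + ε) * (3 / 2)) ≤ (1 - ε / 16) ^ 2 * (k * μ / L) :=
    mul_le_mul_of_nonneg_left hkμ (sq_nonneg _)
  have h2 : 3 / 2 + ε / 4 + ε / 2 ≤ (1 - ε / 16) ^ 2 * ((1 + ε) * (3 / 2)) := by
    nlinarith [mul_pos hε0 (sub_pos.2 hε1), pow_pos hε0 3]
  nlinarith

lemma mixExp_upper_tail_le (hp0 : ∀ a, 0 ≤ p a) (hpz : p 0 = 0) (hp : HasSum p 1)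
    (hμ : HasSum (fun a : ℕ => p a * Real.log a) μ) (hμ0 : 0 < μ) (hL : 0 < L) (hK : 0 < K)
    (hε0 : 0 < ε) (hε1 : ε < 1) {k : ℕ} (hk : (k : ℝ) < (1 - ε) * (3 * L / (2 * μ)))
    {η : ℝ} (hη : 0 < η) (hKη : Real.exp (K * η) ≤ 1 + ε / 4) :
    mixExp p k (fun m => if Real.exp ((3 / 2 - ε / 4) * L) ≤ (m : ℝ) then 1 else 0) ≤
      3 / (2 * η) * ((∑' a : ℕ, p a * if η * L < Real.log a then Real.log a else 0) / μ) +
      Real.exp (-(ε / 2 * K)) := by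
  have hl : 0 ≤ K / L := by positivity
  have hG := laplace_truncated_le hp0 hp hμ (y := η * L) hl
  rw [show K / L * (η * L) = K * η by field_simp] at hG
  have hkμ : k * μ ≤ (1 - ε) * (3 / 2) * L := by
    have := mul_lt_mul_of_pos_right hk hμ0
    rw [show (1 - ε) * (3 * L / (2 * μ)) * μ = (1 - ε) * (3 / 2) * L by field_simp] at this
    exact this.le
  refine (mixExp_upper_tail hp0 hpz hp (y := η * L) hl k _).trans (add_le_add ?_ ?_)
  · have hq := mul_tsum_ite_le hp0 hp hμ.summable (η * L)
    have hq0 : 0 ≤ ∑' a : ℕ, p a * (if η * L < Real.log a then (1 : ℝ) else 0) :=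
      tsum_nonneg fun a => mul_nonneg (hp0 a) (by split_ifs <;> simp)
    set q := ∑' a : ℕ, p a * (if η * L < Real.log a then (1 : ℝ) else 0)
    set T := ∑' a : ℕ, p a * (if η * L < Real.log a then Real.log a else 0)
    rw [div_mul_div_comm, le_div_iff₀ (by positivity)]
    have h1 : k * μ ≤ 3 / 2 * L := hkμ.trans (by nlinarith)
    nlinarith [mul_le_mul_of_nonneg_right h1 (mul_nonneg hq0 hη.le)]
  · have hG0 : 0 ≤ ∑' a : ℕ, p a *
        (if η * L < Real.log a then 0 else Real.exp (K / L * Real.log a)) :=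
      tsum_nonneg fun a => mul_nonneg (hp0 a) (by
        split_ifs
        · exact le_rfl
        · exact Real.exp_nonneg _)
    refine (mul_le_mul_of_nonneg_left (pow_le_pow_left₀ hG0 hG k) (Real.exp_nonneg _)).trans ?_
    rw [← Real.exp_nat_mul, ← Real.exp_add, Real.exp_le_exp]
    rw [show -(K / L) * ((3 / 2 - ε / 4) * L) = -((3 / 2 - ε / 4) * K) by field_simp,
      show (k : ℝ) * (Real.exp (K * η) * (K / L) * μ) =
        Real.exp (K * η) * (k * μ / L) * K by ring]
    have h1 : k * μ / L ≤ (1 - ε) * (3 / 2) := by rwa [div_le_iff₀ hL]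
    have h2 : Real.exp (K * η) * (k * μ / L) ≤ (1 + ε / 4) * ((1 - ε) * (3 / 2)) :=
      mul_le_mul hKη h1 (by positivity) (by linarith)
    have h3 : (1 + ε / 4) * ((1 - ε) * (3 / 2)) ≤ 3 / 2 - ε / 4 - ε / 2 := by nlinarith
    nlinarith

end laplace

section asymptotics

lemma tendsto_exp_neg_mul {c : ℝ} (hc : 0 < c) :
    Tendsto (fun L : ℝ => Real.exp (-(c * L))) atTop (nhds 0) :=
  Real.tendsto_exp_neg_atTop_nhds_zero.comp (tendsto_id.const_mul_atTop hc)

lemma uniform_error_eq {L δ : ℝ} :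
    Real.exp L * Real.exp ((1 + δ) / 2 * L) / (2 * Real.exp ((3 / 2 + δ) * L)) +
      2 * Real.exp L ^ 3 / Real.exp ((3 / 2 + δ) * L) ^ 2 =
      Real.exp (-(δ / 2 * L)) / 2 + 2 * Real.exp (-(2 * δ * L)) := by
  have h1 : Real.exp L * Real.exp ((1 + δ) / 2 * L) =
      Real.exp (-(δ / 2 * L)) * Real.exp ((3 / 2 + δ) * L) := by
    rw [← Real.exp_add, ← Real.exp_add]
    congr 1
    ring
  have h2 : Real.exp L ^ 3 = Real.exp (-(2 * δ * L)) * Real.exp ((3 / 2 + δ) * L) ^ 2 := by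
    rw [← Real.exp_nat_mul, ← Real.exp_nat_mul, ← Real.exp_add]
    congr 1
    push_cast
    ring
  rw [h1, h2]
  have := Real.exp_ne_zero ((3 / 2 + δ) * L)
  field_simp

lemma chebyshev_error_eq {L δ : ℝ} :
    3 * Real.exp L / Real.exp ((1 + δ) / 2 * L) ^ 2 = 3 * Real.exp (-(δ * L)) := by
  rw [← Real.exp_nat_mul, mul_div_assoc, ← Real.exp_sub]
  congr 2
  push_cast
  ring

lemma density_exponent_le {L δ M : ℝ} (hL : 128 ≤ Real.exp (δ / 2 * L)) (hM : 0 < M)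
    (h : M < Real.exp ((3 / 2 - δ) * L)) :
    Real.exp L * Real.exp ((1 + δ) / 2 * L) / (2 * M) - Real.exp L ^ 3 / (128 * M ^ 2) ≤
      -Real.exp (δ * L) := by
  set t := Real.exp (δ / 2 * L) with ht
  set N := Real.exp (3 / 2 * L) / M with hN
  have h1 : Real.exp L * Real.exp ((1 + δ) / 2 * L) / (2 * M) = t * N / 2 := by
    rw [hN, ht, ← mul_div_assoc, div_div, mul_comm M, ← Real.exp_add, ← Real.exp_add]
    congr 2
    ring
  have h2 : Real.exp L ^ 3 / (128 * M ^ 2) = N ^ 2 / 128 := by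
    rw [hN, div_pow, div_div, mul_comm (M ^ 2), ← Real.exp_nat_mul, ← Real.exp_nat_mul]
    congr 2
    push_cast
    ring
  have h3 : Real.exp (δ * L) = t ^ 2 := by
    rw [ht, ← Real.exp_nat_mul]
    congr 1
    push_cast
    ring
  have h4 : t ^ 2 ≤ N := by
    rw [hN, le_div_iff₀ hM, ← h3]
    calc Real.exp (δ * L) * M ≤ Real.exp (δ * L) * Real.exp ((3 / 2 - δ) * L) := by gcongr
      _ = Real.exp (3 / 2 * L) := by rw [← Real.exp_add]; congr 1; ring
  rw [h1, h2, h3]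
  have h5 : 0 ≤ N := (sq_nonneg t).trans h4
  have h6 : t / 2 + 1 ≤ N / 128 := by nlinarith
  nlinarith [mul_le_mul_of_nonneg_left h6 h5]

end asymptotics

/-- Cutoff for `p_n`-shuffles at `t_n = 3 log n / (2 μ_n)` when `μ_n = o(log n)` and
the tails `E[(log X_n)·1{log X_n > η log n}]` are `o(μ_n)`. -/
theorem pn_shuffle_cutoff_moment (p : ℕ → ℕ → ℝ) (hp0 : ∀ n k, 0 ≤ p n k)
    (hpz : ∀ n, p n 0 = 0) (hpsum : ∀ n, ∑' k : ℕ, p n k = 1)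
    (hsum : ∀ n, Summable fun k : ℕ => p n k * Real.log k)
    (μ : ℕ → ℝ) (hμ : ∀ n, μ n = ∑' k : ℕ, p n k * Real.log k)
    (hμpos : ∀ n, 0 < μ n)
    (hsmall : (fun n : ℕ => μ n) =o[Filter.atTop] fun n : ℕ => Real.log n)
    (htail : ∀ η : ℝ, 0 < η →
      (fun n : ℕ => ∑' k : ℕ, p n k *
        (if η * Real.log n < Real.log k then Real.log k else 0))
        =o[Filter.atTop] fun n : ℕ => μ n)
    (ε : ℝ) (hε : ε ∈ Set.Ioo (0 : ℝ) 1) :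
    (∀ k : ℕ → ℕ, (∀ n : ℕ, (1 + ε) * (3 * Real.log n / (2 * μ n)) < (k n : ℝ)) →
      Filter.Tendsto (fun n => tv n (iterConv n (Qp n (p n)) (k n)) (Us n))
        Filter.atTop (nhds 0)) ∧
    (∀ k : ℕ → ℕ, (∀ n : ℕ, 2 ≤ n → (k n : ℝ) < (1 - ε) * (3 * Real.log n / (2 * μ n))) →
      Filter.Tendsto (fun n => tv n (iterConv n (Qp n (p n)) (k n)) (Us n))
        Filter.atTop (nhds 1)) := by
  obtain ⟨hε0, hε1⟩ := hε
  have hp : ∀ n, HasSum (p n) 1 := fun n => by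
    have hs : Summable (p n) := by
      by_contra h
      have := hpsum n
      rw [tsum_eq_zero_of_not_summable h] at this
      exact zero_ne_one this
    exact hpsum n ▸ hs.hasSum
  have hμs : ∀ n, HasSum (fun a : ℕ => p n a * Real.log a) (μ n) := fun n =>
    hμ n ▸ (hsum n).hasSum
  have hlog : Tendsto (fun n : ℕ => Real.log n) atTop atTop :=
    Real.tendsto_log_atTop.comp tendsto_natCast_atTop_atTop
  have hexp : ∀ {c : ℝ}, 0 < c →
      Tendsto (fun n : ℕ => Real.exp (-(c * Real.log n))) atTop (nhds 0) := fun hc =>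
    (tendsto_exp_neg_mul hc).comp hlog
  have hKlim : Tendsto (fun K : ℝ => Real.exp (-(ε / 2 * K))) atTop (nhds 0) :=
    tendsto_exp_neg_mul (by positivity)
  set δ := ε / 4 with hδ
  have hδ0 : 0 < δ := by positivity
  refine ⟨fun k hk => ?_, fun k hk => ?_⟩
  · rw [Metric.tendsto_nhds]
    intro γ hγ
    obtain ⟨K, hKγ, hK⟩ :=
      ((hKlim.eventually_lt_const (half_pos hγ)).and (eventually_gt_atTop 0)).exists
    have herr : Tendsto (fun n : ℕ => 3 * Real.exp (-(δ * Real.log n)) +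
        (Real.exp (-(δ / 2 * Real.log n)) / 2 + 2 * Real.exp (-(2 * δ * Real.log n))))
        atTop (nhds 0) := by
      have := ((hexp hδ0).const_mul 3).add
        (((hexp (half_pos hδ0)).div_const 2).add ((hexp (mul_pos two_pos hδ0)).const_mul 2))
      simpa using this
    filter_upwards [eventually_ge_atTop 1, hlog.eventually_ge_atTop 2,
      herr.eventually_lt_const (half_pos hγ),
      (htail (ε / (8 * K)) (by positivity)).bound (show 0 < ε / 16 by positivity)]
      with n hn hL hsmall_err hT
    have hn0 : (0 : ℝ) < n := by exact_mod_cast hn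
    have hnL : Real.exp (Real.log n) = n := Real.exp_log hn0
    rw [Real.norm_eq_abs, Real.norm_eq_abs, abs_of_pos (hμpos n)] at hT
    have hP := mixExp_lower_tail_le (hp0 n) (hpz n) (hp n) (hμs n) (hμpos n)
      (by linarith : 0 < Real.log n) hK hε0 hε1 (hk n) ((le_abs_self _).trans hT)
    have hX : 2 * (n : ℝ) ≤ Real.exp ((3 / 2 + δ) * Real.log n) := by
      have h2 : (2 : ℝ) ≤ Real.exp ((1 / 2 + δ) * Real.log n) := by
        have := Real.add_one_le_exp ((1 / 2 + δ) * Real.log n)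
        nlinarith
      calc 2 * (n : ℝ) ≤ Real.exp ((1 / 2 + δ) * Real.log n) * n := by gcongr
        _ = Real.exp ((3 / 2 + δ) * Real.log n) := by
          nth_rewrite 2 [← hnL]
          rw [← Real.exp_add]
          congr 1
          ring
    have h := tv_iterConv_Qp_le (hp0 n) (hpz n) (hp n) hn (k n)
      (Real.exp_pos ((1 + δ) / 2 * Real.log n)) hX
    have h1 := chebyshev_error_eq (L := Real.log n) (δ := δ)
    have h2 := uniform_error_eq (L := Real.log n) (δ := δ)
    rw [hnL] at h1 h2
    rw [h1, h2] at h
    have h0 : 0 ≤ tv n (iterConv n (Qp n (p n)) (k n)) (Us n) := by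
      unfold tv
      positivity
    rw [Real.dist_eq, sub_zero, abs_of_nonneg h0]
    linarith
  · rw [Metric.tendsto_nhds]
    intro γ hγ
    obtain ⟨K, hKγ, hK⟩ :=
      ((hKlim.eventually_lt_const (half_pos hγ)).and (eventually_gt_atTop 0)).exists
    set η := Real.log (1 + δ) / K with hη
    have hη0 : 0 < η := div_pos (Real.log_pos (by linarith)) hK
    have hKη : Real.exp (K * η) ≤ 1 + ε / 4 := by
      rw [hη, mul_div_cancel₀ _ hK.ne', Real.exp_log (by linarith)]
    have hgrow : Tendsto (fun n : ℕ => Real.exp (δ * Real.log n)) atTop atTop :=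
      Real.tendsto_exp_atTop.comp (hlog.const_mul_atTop hδ0)
    have herr : Tendsto (fun n : ℕ => 3 * Real.exp (-(δ * Real.log n)) +
        Real.exp (-Real.exp (δ * Real.log n)) + 3 / (2 * η) *
        ((∑' a : ℕ, p n a * if η * Real.log n < Real.log a then Real.log a else 0) / μ n))
        atTop (nhds 0) := by
      have := (((hexp hδ0).const_mul 3).add
        (Real.tendsto_exp_neg_atTop_nhds_zero.comp hgrow)).add
        (((htail η hη0).tendsto_div_nhds_zero).const_mul (3 / (2 * η)))
      simpa using this
    filter_upwards [eventually_ge_atTop 2, hlog.eventually_ge_atTop 8,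
      herr.eventually_lt_const (half_pos hγ),
      (Real.tendsto_exp_atTop.comp
        (hlog.const_mul_atTop (half_pos hδ0))).eventually_ge_atTop 128]
      with n hn hL hsmall_err ht
    have hn0 : (0 : ℝ) < n := by exact_mod_cast (show 0 < n by omega)
    have hnL : Real.exp (Real.log n) = n := Real.exp_log hn0
    have hP := mixExp_upper_tail_le (hp0 n) (hpz n) (hp n) (hμs n) (hμpos n)
      (by linarith : 0 < Real.log n) hK hε0 hε1 (hk n hn) hη0 hKη
    have hxn : Real.exp ((1 + δ) / 2 * Real.log n) ≤ n / 3 := by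
      have h3 : (3 : ℝ) ≤ Real.exp ((1 - δ) / 2 * Real.log n) := by
        have := Real.add_one_le_exp ((1 - δ) / 2 * Real.log n)
        nlinarith
      rw [le_div_iff₀ three_pos]
      calc Real.exp ((1 + δ) / 2 * Real.log n) * 3
          ≤ Real.exp ((1 + δ) / 2 * Real.log n) * Real.exp ((1 - δ) / 2 * Real.log n) := by
            gcongr
        _ = Real.exp (Real.log n) := by
            rw [← Real.exp_add]
            congr 1
            ring
        _ = n := hnL
    have h := le_tv_iterConv_Qp (hp0 n) (hpz n) (hp n) hn (k n)
      (X := (3 / 2 - δ) * Real.log n) (e := Real.exp (-Real.exp (δ * Real.log n)))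
      (Real.exp_pos ((1 + δ) / 2 * Real.log n)) hxn
      (fun m hm hmX => by
        have := density_exponent_le ht (by exact_mod_cast hm) hmX
        rw [hnL] at this
        exact Real.exp_le_exp.2 this) (Real.exp_nonneg _)
    have h1 := chebyshev_error_eq (L := Real.log n) (δ := δ)
    rw [hnL] at h1
    rw [h1] at h
    have h0 := tv_iterConv_Qp_le_one (hp0 n) (hpz n) (hp n) (show 1 ≤ n by omega) (k n)
    rw [Real.dist_eq, abs_sub_comm, abs_of_nonneg (by linarith)]
    linarith
end
end

section
/- For n ≥ 1 let a_n > 0, b_n > 0 and let X_n be a nonnegative real-valued random variable. For c > 0, set Y_n^{(c)} = X_n·1{X_n ≤ c·a_n} and Z_n^{(c)} = Y_n^{(c)} + c·a_n·1{X_n > c·a_n}, and say condition (★c) holds if a_n = O(b_n), lim_{n→∞} b_n·E[(Z_n^{(c)})²]/(a_n²·E[Y_n^{(c)}]) = 0, and lim_{n→∞} b_n/E[Y_n^{(c)}] = ∞. Then: if (★c) holds for some c > 0, it holds for every c > 0; moreover, for all c, d > 0 (with (★c) holding), E[Y_n^{(d)}] ~ E[Y_n^{(c)}] as n → ∞. 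-/
open MeasureTheory

/-- Truncated moment condition (★c) for nonnegative random variables `X_n`:
`a_n = O(b_n)`, `b_n E[(Z_n^{(c)})²]/(a_n² E[Y_n^{(c)}]) → 0` and `b_n / E[Y_n^{(c)}] → ∞`,
where `Y_n^{(c)} = X_n·1{X_n ≤ c a_n}` and `Z_n^{(c)} = Y_n^{(c)} + c a_n·1{X_n > c a_n}`. -/
def StarCond (Ω : ℕ → Type*) [∀ n, MeasurableSpace (Ω n)]
    (P : ∀ n, Measure (Ω n)) (X : ∀ n, Ω n → ℝ) (a b : ℕ → ℝ) (c : ℝ) : Prop :=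
  ((fun n : ℕ => a n) =O[Filter.atTop] fun n : ℕ => b n) ∧
  Filter.Tendsto (fun n : ℕ =>
      b n * (∫ ω, (if X n ω ≤ c * a n then (X n ω) ^ 2 else (c * a n) ^ 2) ∂(P n)) /
        ((a n) ^ 2 * ∫ ω, (if X n ω ≤ c * a n then X n ω else 0) ∂(P n)))
    Filter.atTop (nhds 0) ∧
  Filter.Tendsto (fun n : ℕ =>
      b n / ∫ ω, (if X n ω ≤ c * a n then X n ω else 0) ∂(P n))
    Filter.atTop Filter.atTop

/-- Truncation of a nonnegative number at level `t`, squared, is monotone in `t` up to a factor. -/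
lemma truncated_sq_le {x a c d : ℝ} (hx : 0 ≤ x) (ha : 0 < a) (hc : 0 < c) (hd : 0 < d) :
    (if x ≤ d * a then x ^ 2 else (d * a) ^ 2) ≤
      (1 + d / c) ^ 2 * (if x ≤ c * a then x ^ 2 else (c * a) ^ 2) := by
  have hda : 0 < d * a := mul_pos hd ha
  have hdc : 0 < d / c := div_pos hd hc
  have h1 : (1 : ℝ) ≤ (1 + d / c) ^ 2 := by nlinarith
  have h2 : d * a = d / c * (c * a) := by field_simp
  have h3 : (d * a) ^ 2 ≤ (1 + d / c) ^ 2 * (c * a) ^ 2 := by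
    rw [h2, mul_pow]
    gcongr
    linarith
  split_ifs with h h' h'
  · nlinarith [sq_nonneg x]
  · exact (pow_le_pow_left₀ hx h 2).trans h3
  · exact (pow_le_pow_left₀ hda.le (not_le.1 h).le 2).trans (by nlinarith [sq_nonneg x])
  · exact h3

/-- Cutting off a nonnegative number at levels `d * a` and `c * a` differs by at most a multiple of
its squared truncation at level `c * a`. -/
lemma abs_cutoff_sub_cutoff_le {x a c d : ℝ} (hx : 0 ≤ x) (ha : 0 < a) (hc : 0 < c) (hd : 0 < d) :
    |(if x ≤ d * a then x else 0) - (if x ≤ c * a then x else 0)| ≤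
      (d / c ^ 2 + 1 / d) / a * (if x ≤ c * a then x ^ 2 else (c * a) ^ 2) := by
  have hL : 0 ≤ (d / c ^ 2 + 1 / d) / a := by positivity
  split_ifs with h h' h'
  · rw [sub_self, abs_zero]
    positivity
  · rw [sub_zero, abs_of_nonneg hx]
    have : (d / c ^ 2 + 1 / d) / a * (c * a) ^ 2 = d * a + c ^ 2 * a / d := by field_simp
    rw [this]
    have : 0 ≤ c ^ 2 * a / d := by positivity
    linarith
  · rw [zero_sub, abs_neg, abs_of_nonneg hx]
    have h4 : (d / c ^ 2 + 1 / d) / a * x ^ 2 = d / c ^ 2 / a * x ^ 2 + x * x / (d * a) := by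
      field_simp
    have h5 : x ≤ x * x / (d * a) := by
      rw [le_div_iff₀ (by positivity)]
      exact mul_le_mul_of_nonneg_left (not_le.1 h).le hx
    have : 0 ≤ d / c ^ 2 / a * x ^ 2 := by positivity
    linarith
  · rw [sub_self, abs_zero]
    positivity

section

variable {Ω : Type*} [MeasurableSpace Ω] {P : Measure Ω} [IsFiniteMeasure P] {X : Ω → ℝ}

lemma integrable_cutoff (hX0 : ∀ ω, 0 ≤ X ω) (hXm : Measurable X) (t : ℝ) :
    Integrable (fun ω => if X ω ≤ t then X ω else 0) P := by
  refine Integrable.of_bound (C := |t|) (Measurable.ite (measurableSet_le hXm measurable_const)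
    hXm measurable_const).aestronglyMeasurable (.of_forall fun ω => ?_)
  split_ifs with h
  · rw [Real.norm_of_nonneg (hX0 ω)]
    exact h.trans (le_abs_self t)
  · simp

lemma integrable_truncated_sq (hX0 : ∀ ω, 0 ≤ X ω) (hXm : Measurable X) (t : ℝ) :
    Integrable (fun ω => if X ω ≤ t then X ω ^ 2 else t ^ 2) P := by
  refine Integrable.of_bound (C := t ^ 2) (Measurable.ite (measurableSet_le hXm measurable_const)
    (hXm.pow_const 2) measurable_const).aestronglyMeasurable (.of_forall fun ω => ?_)
  split_ifs with h
  · rw [Real.norm_of_nonneg (sq_nonneg _)]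
    exact pow_le_pow_left₀ (hX0 ω) h 2
  · rw [Real.norm_of_nonneg (sq_nonneg _)]

lemma integral_truncated_sq_le (hX0 : ∀ ω, 0 ≤ X ω) (hXm : Measurable X) {a c d : ℝ}
    (ha : 0 < a) (hc : 0 < c) (hd : 0 < d) :
    ∫ ω, (if X ω ≤ d * a then X ω ^ 2 else (d * a) ^ 2) ∂P ≤
      (1 + d / c) ^ 2 * ∫ ω, (if X ω ≤ c * a then X ω ^ 2 else (c * a) ^ 2) ∂P := by
  rw [← integral_const_mul]
  exact integral_mono (integrable_truncated_sq hX0 hXm _)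
    ((integrable_truncated_sq hX0 hXm _).const_mul _)
    fun ω => truncated_sq_le (hX0 ω) ha hc hd

lemma abs_integral_cutoff_sub_le (hX0 : ∀ ω, 0 ≤ X ω) (hXm : Measurable X) {a c d : ℝ}
    (ha : 0 < a) (hc : 0 < c) (hd : 0 < d) :
    |∫ ω, (if X ω ≤ d * a then X ω else 0) ∂P - ∫ ω, (if X ω ≤ c * a then X ω else 0) ∂P| ≤
      (d / c ^ 2 + 1 / d) / a * ∫ ω, (if X ω ≤ c * a then X ω ^ 2 else (c * a) ^ 2) ∂P := by
  rw [← integral_sub (integrable_cutoff hX0 hXm _) (integrable_cutoff hX0 hXm _),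
    ← integral_const_mul]
  refine abs_integral_le_integral_abs.trans ?_
  exact integral_mono ((integrable_cutoff hX0 hXm _).sub (integrable_cutoff hX0 hXm _)).abs
    ((integrable_truncated_sq hX0 hXm _).const_mul _)
    fun ω => abs_cutoff_sub_cutoff_le (hX0 ω) ha hc hd

end

open Filter Topology

lemma eventually_pos_of_tendsto_div_atTop {b m : ℕ → ℝ} (hb : ∀ n, 0 < b n)
    (h : Tendsto (fun n => b n / m n) atTop atTop) : ∀ᶠ n in atTop, 0 < m n := by
  filter_upwards [h.eventually_gt_atTop 0] with n hn
  exact (div_pos_iff_of_pos_left (hb n)).1 hn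

section

variable {Ω : ℕ → Type*} [∀ n, MeasurableSpace (Ω n)] {P : ∀ n, Measure (Ω n)}
  [∀ n, IsProbabilityMeasure (P n)] {X : ∀ n, Ω n → ℝ} {a b : ℕ → ℝ} {c d : ℝ}

lemma StarCond.tendsto_integral_cutoff_div (hX0 : ∀ n ω, 0 ≤ X n ω) (hXm : ∀ n, Measurable (X n))
    (ha : ∀ n, 0 < a n) (hb : ∀ n, 0 < b n) (hc : 0 < c) (hd : 0 < d)
    (h : StarCond Ω P X a b c) :
    Tendsto (fun n : ℕ => (∫ ω, (if X n ω ≤ d * a n then X n ω else 0) ∂(P n)) /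
      ∫ ω, (if X n ω ≤ c * a n then X n ω else 0) ∂(P n)) atTop (𝓝 1) := by
  obtain ⟨hab, hsq, hinf⟩ := h
  have hab' : (fun n => a n / b n) =O[atTop] fun _ => (1 : ℝ) := by
    simpa [div_eq_mul_inv, mul_inv_cancel₀ (hb _).ne'] using
      hab.mul (Asymptotics.isBigO_refl (fun n => (b n)⁻¹) atTop)
  have hzero := ((Asymptotics.isLittleO_one_iff ℝ).2 hsq).mul_isBigO hab'
  simp only [mul_one] at hzero
  have hlim := ((Asymptotics.isLittleO_one_iff ℝ).1 hzero).const_mul (d / c ^ 2 + 1 / d)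
  rw [mul_zero] at hlim
  rw [tendsto_iff_norm_sub_tendsto_zero]
  refine squeeze_zero' (.of_forall fun _ => norm_nonneg _) ?_ hlim
  filter_upwards [eventually_pos_of_tendsto_div_atTop hb hinf] with n hn
  have hsub := abs_integral_cutoff_sub_le (P := P n) (hX0 n) (hXm n) (ha n) hc hd
  have han := ha n
  have hbn := hb n
  rw [div_sub_one hn.ne', Real.norm_eq_abs, abs_div, abs_of_pos hn, div_le_iff₀ hn]
  refine hsub.trans_eq ?_
  generalize (∫ ω, (if X n ω ≤ c * a n then X n ω else 0) ∂(P n)) = m at hn ⊢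
  field_simp

lemma StarCond.of_level (hX0 : ∀ n ω, 0 ≤ X n ω) (hXm : ∀ n, Measurable (X n))
    (ha : ∀ n, 0 < a n) (hb : ∀ n, 0 < b n) (hc : 0 < c) (hd : 0 < d)
    (h : StarCond Ω P X a b c) : StarCond Ω P X a b d := by
  have hratio := h.tendsto_integral_cutoff_div hX0 hXm ha hb hc hd
  obtain ⟨hab, hsq, hinf⟩ := h
  have hmc := eventually_pos_of_tendsto_div_atTop hb hinf
  have hmd : ∀ᶠ n in atTop, 0 < ∫ ω, (if X n ω ≤ d * a n then X n ω else 0) ∂(P n) := by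
    filter_upwards [hratio.eventually_const_lt one_pos, hmc] with n hn hn'
    exact (div_pos_iff_of_pos_right hn').1 hn
  have hinv := hratio.inv₀ one_ne_zero
  simp only [inv_div, inv_one] at hinv
  refine ⟨hab, ?_, ?_⟩
  · have hlim := (hsq.mul hinv).const_mul ((1 + d / c) ^ 2)
    rw [zero_mul, mul_zero] at hlim
    refine squeeze_zero' ?_ ?_ hlim
    · filter_upwards [hmd] with n hn
      refine div_nonneg (mul_nonneg (hb n).le (integral_nonneg fun ω => ?_)) (by positivity)
      dsimp only [Pi.zero_apply]
      positivity
    · filter_upwards [hmc, hmd] with n hn hn'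
      have hle := integral_truncated_sq_le (P := P n) (hX0 n) (hXm n) (ha n) hc hd
      have han := ha n
      have hbn := hb n
      generalize (∫ ω, (if X n ω ≤ c * a n then X n ω else 0) ∂(P n)) = m at hn ⊢
      generalize (∫ ω, (if X n ω ≤ d * a n then X n ω else 0) ∂(P n)) = m' at hn' ⊢
      calc _ ≤ b n * ((1 + d / c) ^ 2 * _) / (a n ^ 2 * m') := by gcongr
        _ = _ := by field_simp
  · refine (hinf.atTop_mul_pos one_pos hinv).congr' ?_
    filter_upwards [hmc] with n hn
    exact div_mul_div_cancel₀ hn.ne'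

end

/-- If (★c) holds for some `c > 0` then it holds for every `c > 0`, and the truncated
means at different levels are asymptotically equivalent. -/
theorem star_cond_independent_of_level (Ω : ℕ → Type*) [∀ n, MeasurableSpace (Ω n)]
    (P : ∀ n, Measure (Ω n)) [∀ n, IsProbabilityMeasure (P n)]
    (X : ∀ n, Ω n → ℝ) (hX0 : ∀ n ω, 0 ≤ X n ω) (hXm : ∀ n, Measurable (X n))
    (a b : ℕ → ℝ) (hapos : ∀ n, 0 < a n) (hbpos : ∀ n, 0 < b n)
    (h : ∃ c : ℝ, 0 < c ∧ StarCond Ω P X a b c) :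
    (∀ c : ℝ, 0 < c → StarCond Ω P X a b c) ∧
    (∀ c d : ℝ, 0 < c → 0 < d →
      Filter.Tendsto (fun n : ℕ =>
          (∫ ω, (if X n ω ≤ d * a n then X n ω else 0) ∂(P n)) /
            ∫ ω, (if X n ω ≤ c * a n then X n ω else 0) ∂(P n))
        Filter.atTop (nhds 1)) := by
  obtain ⟨c₀, hc₀, h₀⟩ := h
  have hall : ∀ c : ℝ, 0 < c → StarCond Ω P X a b c := fun c hc =>
    h₀.of_level hX0 hXm hapos hbpos hc₀ hc
  exact ⟨hall, fun c d hc hd =>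
    (hall c hc).tendsto_integral_cutoff_div hX0 hXm hapos hbpos hc hd⟩
end
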